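/- arXiv:2108.10770 — 9 statements merged into one kernel-verified Lean document; each statement's English description precedes it below -/
import Mathlib

section
/- Let A = (a_1, a_2, …) be a sequence over a field K with period n (so a_{t+n} = a_t for all t ≥ 1). Then the rank over K of the n×n circulant matrix M_cir(A) equals the linear complexity L(A) of the sequence A. -/
/-- The sequence `a` (indexed from 1) satisfies a linear recurrence of order `L`:
`a (t+L) = λ₁ a (t+L-1) + ⋯ + λ_L a t` for all `t ≥ 1`. -/
def IsLinearRecurrence {K : Type*} [Field K] (a : ℕ → K) (L : ℕ) : Prop :=
  ∃ lam : Fin L → K, ∀ t, 1 ≤ t → a (t + L) = ∑ i : Fin L, lam i * a (t + L - 1 - (i : ℕ))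

/-- The linear complexity of a sequence: the least order of a linear recurrence it satisfies. -/
noncomputable def linComplexity {K : Type*} [Field K] (a : ℕ → K) : ℕ :=
  sInf {L | IsLinearRecurrence a L}

/-- The `n × n` circulant matrix of a sequence of period `n` (indexed from 1):
its `(i,j)` entry is `a (((j - i) mod n) + 1)`. -/
def circMatrix {K : Type*} [Field K] (n : ℕ) (a : ℕ → K) : Matrix (Fin n) (Fin n) K :=
  Matrix.of fun i j => a (((j - i : Fin n) : ℕ) + 1)

section helpers

variable {K : Type*} [Field K]

/-- Windows of length `n` of the sequence. -/
def circWindow (n : ℕ) (a : ℕ → K) (k : ℕ) : Fin n → K := fun j => a (k + j + 1)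

lemma circ_mod {n : ℕ} (a : ℕ → K) (hper : ∀ t, 1 ≤ t → a (t + n) = a t) (x : ℕ) :
    a (x % n + 1) = a (x + 1) := by
  have h : Function.Periodic (fun t => a (t + 1)) n := by
    intro t
    have := hper (t + 1) (by omega)
    simp only
    rw [← this]
    congr 1
    omega
  exact h.map_mod_nat x

lemma range_row {n : ℕ} (hn : 0 < n)
    (a : ℕ → K) (hper : ∀ t, 1 ≤ t → a (t + n) = a t) :
    Set.range (circMatrix n a).row = Set.range (circWindow n a) := by
  have hrow : ∀ i : Fin n, (circMatrix n a).row i = circWindow n a (n - i) := by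
    intro i
    funext j
    simp only [circMatrix, circWindow, Matrix.row, Matrix.of_apply, Fin.sub_def]
    exact circ_mod a hper _
  ext v
  constructor
  · rintro ⟨i, rfl⟩
    exact ⟨_, (hrow i).symm⟩
  · rintro ⟨k, rfl⟩
    refine ⟨⟨(n - k % n) % n, Nat.mod_lt _ hn⟩, ?_⟩
    rw [hrow]
    funext j
    simp only [circWindow]
    have hk := Nat.mod_lt k hn
    rw [← circ_mod a hper (k + j), ← circ_mod a hper (n - _ + j)]
    congr 2
    rw [Nat.add_mod, Nat.add_mod k]
    congr 2
    rcases Nat.eq_zero_or_pos (k % n) with h | h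
    · simp [h]
    · rw [Nat.mod_eq_of_lt (by omega : n - k % n < n)]
      rw [show n - (n - k % n) = k % n by omega, Nat.mod_mod]

lemma isLinRec_iff {n : ℕ} (hn : 0 < n)
    (a : ℕ → K) (hper : ∀ t, 1 ≤ t → a (t + n) = a t) (L : ℕ) :
    IsLinearRecurrence a L ↔
      circWindow n a L ∈ Submodule.span K (Set.range fun i : Fin L => circWindow n a i) := by
  rw [Submodule.mem_span_range_iff_exists_fun]
  constructor
  · rintro ⟨lam, h⟩
    refine ⟨fun i => lam i.rev, ?_⟩
    funext j
    have := h (j + 1) (by omega)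
    simp only [circWindow, Finset.sum_apply, Pi.smul_apply, smul_eq_mul]
    rw [show L + (j : ℕ) + 1 = j + 1 + L by omega, this, ← Equiv.sum_comp Fin.revPerm]
    refine Finset.sum_congr rfl fun i _ => ?_
    simp only [Fin.revPerm_apply, Fin.rev_rev, Fin.val_rev]
    congr 2
    omega
  · rintro ⟨c, h⟩
    refine ⟨fun i => c i.rev, fun t ht => ?_⟩
    have := congrFun h ⟨(t - 1) % n, Nat.mod_lt _ hn⟩
    simp only [circWindow, Finset.sum_apply, Pi.smul_apply, smul_eq_mul] at this
    have key : ∀ k, a (k + (t - 1) % n + 1) = a (k + t) := by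
      intro k
      rw [← circ_mod a hper, Nat.add_mod_mod, circ_mod a hper]
      congr 1
      omega
    simp only [key] at this
    rw [add_comm t L, ← this, ← Equiv.sum_comp Fin.revPerm]
    refine Finset.sum_congr rfl fun i _ => ?_
    simp only [Fin.revPerm_apply, Fin.rev_rev, Fin.val_rev]
    congr 2
    omega

lemma span_le_of_rec {n : ℕ} (a : ℕ → K) (L : ℕ) (h : IsLinearRecurrence a L) (k : ℕ) :
    circWindow n a k ∈ Submodule.span K (Set.range fun i : Fin L => circWindow n a i) := by
  induction k using Nat.strong_induction_on with
  | _ k ih =>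
    rcases lt_or_ge k L with hk | hk
    · exact Submodule.subset_span ⟨⟨k, hk⟩, rfl⟩
    · obtain ⟨lam, h⟩ := h
      have : circWindow n a k = ∑ i : Fin L, lam i • circWindow n a (k - 1 - i) := by
        funext j
        simp only [circWindow, Finset.sum_apply, Pi.smul_apply, smul_eq_mul]
        have := h (k - L + j + 1) (by omega)
        rw [show k + (j : ℕ) + 1 = k - L + j + 1 + L by omega, this]
        refine Finset.sum_congr rfl fun i _ => ?_
        congr 2
        omega
      rw [this]
      exact Submodule.sum_mem _ fun i _ => Submodule.smul_mem _ _ (ih _ (by omega))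

lemma indep_of_min {n : ℕ} (hn : 0 < n)
    (a : ℕ → K) (hper : ∀ t, 1 ≤ t → a (t + n) = a t) (m : ℕ)
    (hm : ∀ k < m, ¬ IsLinearRecurrence a k) :
    LinearIndependent K (fun i : Fin m => circWindow n a i) := by
  induction m with
  | zero => exact linearIndependent_empty_type
  | succ m ih =>
    rw [linearIndependent_finSucc']
    refine ⟨ih fun k hk => hm k (by omega), ?_⟩
    have := hm m (by omega)
    rw [isLinRec_iff hn a hper] at this
    exact this

end helpers

/-- For a sequence `a` of period `n` over a field `K`, the rank of
its circulant matrix equals its linear complexity. -/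
theorem rank_circMatrix_eq_linComplexity {K : Type*} [Field K] {n : ℕ} (hn : 0 < n)
    (a : ℕ → K) (hper : ∀ t, 1 ≤ t → a (t + n) = a t) :
    (circMatrix n a).rank = linComplexity a := by
  classical
  have hne : ({L | IsLinearRecurrence a L} : Set ℕ).Nonempty := by
    refine ⟨n, (isLinRec_iff hn a hper n).2 (Submodule.subset_span ⟨⟨0, hn⟩, ?_⟩)⟩
    funext j
    simp only [circWindow]
    rw [← hper _ (by omega)]
    congr 1
    omega
  have hrec : IsLinearRecurrence a (linComplexity a) := Nat.sInf_mem hne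
  have hli := indep_of_min hn a hper (linComplexity a) fun k hk => Nat.notMem_of_lt_sInf hk
  rw [Matrix.rank_eq_finrank_span_row, range_row hn a hper]
  have hspan : Submodule.span K (Set.range (circWindow n a)) =
      Submodule.span K (Set.range fun i : Fin (linComplexity a) => circWindow n a i) := by
    apply le_antisymm
    · rw [Submodule.span_le]
      rintro _ ⟨k, rfl⟩
      exact span_le_of_rec a _ hrec k
    · apply Submodule.span_mono
      rintro _ ⟨k, rfl⟩
      exact ⟨_, rfl⟩
  rw [hspan, finrank_span_eq_card hli, Fintype.card_fin]
end

section
/- Let A = (a_1, a_2, …) be a sequence over a field K with period n, and let B = A(s, l) be the regular sampling of A with starting point s ≥ 1 and step l ≥ 1, i.e., b_i = a_{s + l·(i−1)} for all i ≥ 1. If gcd(l, n) = 1, then (1) n is a period of B, and (2) the linear complexities satisfy L(A) = L(B). -/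
theorem aux_finrank {K V : Type*} [Field K] [AddCommGroup V] [Module K V]
    (T : V →ₗ[K] V) (v : ℕ → V) (hT : ∀ k, v (k + 1) = T (v k))
    (hne : ∃ L, v L ∈ Submodule.span K (Set.range fun i : Fin L => v i)) :
    sInf {L | v L ∈ Submodule.span K (Set.range fun i : Fin L => v i)}
      = Module.finrank K (Submodule.span K (Set.range v)) := by
  set L := sInf {L | v L ∈ Submodule.span K (Set.range fun i : Fin L => v i)} with hL
  have hmem : v L ∈ Submodule.span K (Set.range fun i : Fin L => v i) := Nat.sInf_mem hne
  have hlt : ∀ m < L, v m ∉ Submodule.span K (Set.range fun i : Fin m => v i) :=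
    fun m hm => Nat.notMem_of_lt_sInf hm
  have hsmall : ∀ k ≤ L, v k ∈ Submodule.span K (Set.range fun i : Fin L => v i) := by
    intro k hk
    rcases hk.lt_or_eq with h | h
    · exact Submodule.subset_span ⟨⟨k, h⟩, rfl⟩
    · rw [h]; exact hmem
  have hinv : Submodule.span K (Set.range fun i : Fin L => v i) ≤
      (Submodule.span K (Set.range fun i : Fin L => v i)).comap T := by
    rw [Submodule.span_le]
    rintro _ ⟨i, rfl⟩
    change T (v i) ∈ Submodule.span K (Set.range fun i : Fin L => v i)
    rw [← hT]
    exact hsmall _ i.2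
  have hall : ∀ k, v k ∈ Submodule.span K (Set.range fun i : Fin L => v i) := by
    intro k
    induction k with
    | zero => exact hsmall 0 (Nat.zero_le _)
    | succ k ih => rw [hT]; exact hinv ih
  have heq : Submodule.span K (Set.range v)
      = Submodule.span K (Set.range fun i : Fin L => v i) := by
    apply le_antisymm
    · rw [Submodule.span_le]
      rintro _ ⟨i, rfl⟩
      exact hall i
    · apply Submodule.span_mono
      rintro _ ⟨i, rfl⟩
      exact ⟨i, rfl⟩
  have hind : ∀ m ≤ L, LinearIndependent K (fun i : Fin m => v i) := by
    intro m
    induction m with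
    | zero => intro _; exact linearIndependent_empty_type
    | succ m ih =>
      intro hm
      rw [linearIndependent_finSucc']
      refine ⟨ih (by omega), ?_⟩
      have := hlt m (by omega)
      simpa [Fin.init_def] using this
  rw [heq, finrank_span_eq_card (hind L le_rfl), Fintype.card_fin]

theorem aux_rec {K : Type*} [Field K] {n : ℕ} [NeZero n] (a : ℕ → K) (f : ZMod n → K)
    (hf : ∀ t, 1 ≤ t → a t = f t) (L : ℕ) :
    IsLinearRecurrence a L ↔ (fun x : ZMod n => f (x + (L : ℕ))) ∈
      Submodule.span K (Set.range fun i : Fin L => fun x : ZMod n => f (x + ((i : ℕ) : ZMod n))) := by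
  have hr : (Set.range fun i : Fin L => fun x : ZMod n => f (x + ((i : ℕ) : ZMod n)))
      = Set.range fun i : Fin L => fun x : ZMod n => f (x + ((i.rev : ℕ) : ZMod n)) :=
    (Function.Surjective.range_comp Fin.rev_surjective
      (fun i : Fin L => fun x : ZMod n => f (x + ((i : ℕ) : ZMod n)))).symm
  rw [hr, Submodule.mem_span_range_iff_exists_fun]
  have key : ∀ t, 1 ≤ t → ∀ i : Fin L,
      a (t + L - 1 - (i : ℕ)) = f ((t : ZMod n) + ((i.rev : ℕ) : ZMod n)) := by
    intro t ht i
    have h2 := i.2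
    have h3 : t + L - 1 - (i : ℕ) = t + (i.rev : ℕ) := by rw [Fin.val_rev]; omega
    rw [h3, hf _ (by omega)]
    push_cast
    rfl
  unfold IsLinearRecurrence
  refine exists_congr fun lam => ⟨fun h => ?_, fun h t ht => ?_⟩
  · ext x
    have hpos : 1 ≤ x.val + n := by have := NeZero.pos n; omega
    have hx : ((x.val + n : ℕ) : ZMod n) = x := by simp
    have := h (x.val + n) hpos
    rw [hf _ (by omega), Nat.cast_add _ L, hx] at this
    rw [this, Finset.sum_apply]
    refine Finset.sum_congr rfl fun i _ => ?_
    rw [key _ hpos, hx]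
    rfl
  · have := congrFun h (t : ZMod n)
    rw [hf _ (by omega), Nat.cast_add, ← this, Finset.sum_apply]
    refine Finset.sum_congr rfl fun i _ => ?_
    rw [key _ ht]
    rfl

theorem aux_lin {K : Type*} [Field K] {n : ℕ} [NeZero n] (a : ℕ → K) (f : ZMod n → K)
    (hf : ∀ t, 1 ≤ t → a t = f t) :
    linComplexity a = Module.finrank K (Submodule.span K
      (Set.range fun c : ZMod n => fun x : ZMod n => f (x + c))) := by
  have hr : (Set.range fun c : ZMod n => fun x : ZMod n => f (x + c))
      = Set.range fun k : ℕ => fun x : ZMod n => f (x + (k : ZMod n)) :=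
    (Function.Surjective.range_comp (ZMod.natCast_zmod_surjective (n := n))
      (fun c : ZMod n => fun x : ZMod n => f (x + c))).symm
  unfold linComplexity
  simp_rw [aux_rec a f hf]
  rw [hr]
  apply aux_finrank (LinearMap.funLeft K K (fun x : ZMod n => x + 1))
    (fun k : ℕ => fun x : ZMod n => f (x + (k : ZMod n)))
  · intro k
    ext x
    simp only [LinearMap.funLeft_apply]
    push_cast
    congr 1
    ring
  · refine ⟨n, Submodule.subset_span ⟨⟨0, NeZero.pos n⟩, ?_⟩⟩
    simp

theorem aux_per {K : Type*} {n : ℕ} (a : ℕ → K) (hper : ∀ t, 1 ≤ t → a (t + n) = a t)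
    (k t : ℕ) (ht : 1 ≤ t) : a (t + n * k) = a t := by
  induction k with
  | zero => simp
  | succ k ih => rw [Nat.mul_succ, ← add_assoc, hper _ (by omega), ih]

/-- If `b = a(s, l)` is the regular sampling `b i = a (s + l(i-1))` of a
sequence `a` of period `n`, and `gcd l n = 1`, then `n` is a period of `b` and
`L(a) = L(b)`. -/
theorem linComplexity_regular_sampling {K : Type*} [Field K] {n s l : ℕ}
    (hn : 0 < n) (hs : 1 ≤ s) (hl : 1 ≤ l)
    (a : ℕ → K) (hper : ∀ t, 1 ≤ t → a (t + n) = a t)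
    (b : ℕ → K) (hb : ∀ i, 1 ≤ i → b i = a (s + l * (i - 1)))
    (hgcd : Nat.gcd l n = 1) :
    (∀ t, 1 ≤ t → b (t + n) = b t) ∧ linComplexity a = linComplexity b := by
  refine ⟨fun t ht => ?_, ?_⟩
  · rw [hb _ (by omega), hb _ ht]
    have : s + l * (t + n - 1) = s + l * (t - 1) + n * l := by
      obtain ⟨u, rfl⟩ : ∃ u, t = u + 1 := ⟨t - 1, by omega⟩
      have : u + 1 + n - 1 = u + n := by omega
      rw [this, Nat.add_sub_cancel]; ring
    rw [this, aux_per a hper _ _ (by omega)]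
  · haveI : NeZero n := ⟨hn.ne'⟩
    obtain ⟨f, hf⟩ : ∃ f : ZMod n → K, ∀ t, 1 ≤ t → a t = f t := by
      refine ⟨fun x => a (x.val + n), fun t ht => ?_⟩
      simp only [ZMod.val_natCast]
      rw [← hper t ht, ← aux_per a hper (t / n) (t % n + n) (by omega)]
      congr 1
      have := Nat.mod_add_div t n
      omega
    let u : (ZMod n)ˣ := ZMod.unitOfCoprime l hgcd
    have hu : (u : ZMod n) = l := ZMod.coe_unitOfCoprime l hgcd
    let φ : ZMod n ≃ ZMod n := (Units.mulLeft u).trans (Equiv.addLeft ((s : ZMod n) - l))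
    have hφ : ∀ x, φ x = (s - l) + l * x := fun x => by
      simp [φ, hu]
    have hg : ∀ t, 1 ≤ t → b t = (f ∘ φ) t := by
      intro t ht
      rw [hb t ht, hf _ (by omega), Function.comp_apply, hφ]
      push_cast [Nat.cast_sub ht]
      congr 1
      ring
    rw [aux_lin a f hf, aux_lin b (f ∘ φ) hg]
    let e := LinearEquiv.funCongrLeft K K φ
    rw [← LinearEquiv.finrank_map_eq e, Submodule.map_span, ← Set.range_comp]
    have hr := Function.Surjective.range_comp (Units.mulLeft u).surjective
      (e ∘ fun c : ZMod n => fun x : ZMod n => f (x + c))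
    have hfun : (fun c : ZMod n => fun x : ZMod n => (f ∘ φ) (x + c))
        = (e ∘ fun c : ZMod n => fun x : ZMod n => f (x + c)) ∘ (Units.mulLeft u) := by
      funext c x
      change f (φ (x + c)) = f (φ x + u * c)
      rw [hφ, hφ, hu]
      congr 1
      ring
    rw [hfun, hr]
    rfl
end

section
/- Let K be a field, n a positive integer, r ∈ K, and let M = Cir_n^r(w_1, …, w_n) be the n×n r-circulant matrix over K. Set w(x) = Σ_{i=0}^{n−1} w_{i+1} x^i. Suppose θ, ξ ∈ K satisfy θ^n = r and ξ is a primitive n-th root of unity (so the n elements θξ^i, i = 0, …, n−1, are exactly the roots of x^n − r in K). Then the characteristic polynomial of M equals ∏_{i=0}^{n−1} (X − w(θξ^i)); in particular, the eigenvalues of M are exactly the values w(θξ^i) for i = 0, 1, …, n−1. -/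
/-- The `n × n` `r`-circulant matrix with first row `w 0, w 1, …, w (n-1)`
(1-indexed: `a_1, …, a_n`): its `(i,j)` entry is `w (j-i)` when `j ≥ i` and
`r * w (n+j-i)` when `j < i` (here `j - i` is subtraction in `Fin n`, i.e. mod `n`). -/
def rCirculant {K : Type*} [Field K] {n : ℕ} (r : K) (w : Fin n → K) :
    Matrix (Fin n) (Fin n) K :=
  Matrix.of fun i j => if (i : ℕ) ≤ (j : ℕ) then w (j - i) else r * w (j - i)

/-- Row identity: `x ↦ (x^j)_j` is an eigenvector with eigenvalue `w(x)` when `x^n = r`. -/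
theorem rCirculant_row {K : Type*} [Field K] {n : ℕ} (hn : 0 < n)
    (r : K) (w : Fin n → K) (x : K) (hx : x ^ n = r) (i : Fin n) :
    ∑ j : Fin n, rCirculant r w i j * x ^ (j : ℕ) =
      x ^ (i : ℕ) * ∑ k : Fin n, w k * x ^ (k : ℕ) := by
  have : NeZero n := ⟨hn.ne'⟩
  rw [← Equiv.sum_comp (Equiv.subRight i) (fun k : Fin n => w k * x ^ (k : ℕ)), Finset.mul_sum]
  refine Finset.sum_congr rfl fun j _ => ?_
  simp only [rCirculant, Matrix.of_apply, Equiv.subRight_apply]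
  split_ifs with h
  · have h1 : ((j - i : Fin n) : ℕ) = j - i := Fin.coe_sub_iff_le.2 h
    have h2 : x ^ (j : ℕ) = x ^ (i : ℕ) * x ^ ((j : ℕ) - i) := by
      rw [← pow_add]; congr 1; omega
    rw [h1, h2]; ring
  · have h1 : ((j - i : Fin n) : ℕ) = n + j - i := Fin.coe_sub_iff_lt.2 (not_le.1 h)
    have h2 : r * x ^ (j : ℕ) = x ^ (i : ℕ) * x ^ (n + (j : ℕ) - i) := by
      rw [← hx, ← pow_add, ← pow_add]; congr 1; omega
    rw [h1, mul_left_comm, ← h2]; ring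

/-- If `θ ^ n = r` and `ξ` is a primitive `n`-th root of unity in `K`,
then the characteristic polynomial of the `r`-circulant matrix `Cirₙʳ (w₁, …, wₙ)` is
`∏_{i=0}^{n-1} (X - w(θ ξ^i))` where `w(x) = Σ_{k=0}^{n-1} w_{k+1} x^k`; in particular
its eigenvalues are exactly the values `w(θ ξ^i)`. -/
theorem charpoly_rCirculant {K : Type*} [Field K] {n : ℕ} (hn : 0 < n)
    (r : K) (w : Fin n → K) (θ ξ : K) (hθ : θ ^ n = r)
    (hξ : IsPrimitiveRoot ξ n) :
    (rCirculant r w).charpoly =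
      ∏ i ∈ Finset.range n,
        (Polynomial.X - Polynomial.C (∑ k : Fin n, w k * (θ * ξ ^ i) ^ (k : ℕ))) := by
  have : NeZero n := ⟨hn.ne'⟩
  rcases eq_or_ne θ 0 with h0 | h0
  · have hr : r = 0 := by rw [← hθ, h0, zero_pow hn.ne']
    have hu : (rCirculant r w).BlockTriangular id := by
      intro i j hij
      have : ¬ (i : ℕ) ≤ (j : ℕ) := not_le.2 hij
      rw [rCirculant, Matrix.of_apply, if_neg this, hr, zero_mul]
    have hs : ∀ i : ℕ, ∑ k : Fin n, w k * (θ * ξ ^ i) ^ (k : ℕ) = w 0 := by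
      intro i
      rw [Finset.sum_eq_single 0]
      · simp
      · intro k _ hk
        have : (k : ℕ) ≠ 0 := fun h => hk (Fin.ext (by simpa using h))
        simp [h0, this]
      · simp
    rw [Matrix.charpoly_of_isUpperTriangular _ hu]
    simp [hs, rCirculant]
  · set v : Fin n → K := fun i => θ * ξ ^ (i : ℕ) with hv
    set d : Fin n → K := fun i => ∑ k : Fin n, w k * v i ^ (k : ℕ) with hd
    have hinj : Function.Injective v := by
      intro i j hij
      exact Fin.ext (hξ.pow_inj i.2 j.2 (mul_left_cancel₀ h0 hij))
    set V : Matrix (Fin n) (Fin n) K := (Matrix.vandermonde v).transpose with hV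
    have hdet : IsUnit V := by
      rw [Matrix.isUnit_iff_isUnit_det, hV, Matrix.det_transpose]
      exact isUnit_iff_ne_zero.2 (Matrix.det_vandermonde_ne_zero_iff.2 hinj)
    have hvn : ∀ i, v i ^ n = r := by
      intro i
      simp only [hv]
      rw [mul_pow, hθ, ← pow_mul, mul_comm (i : ℕ), pow_mul, hξ.pow_eq_one, one_pow, mul_one]
    have hmul : rCirculant r w * V = V * Matrix.diagonal d := by
      ext i j
      rw [Matrix.mul_diagonal, Matrix.mul_apply]
      simpa [hV, Matrix.vandermonde_apply] using rCirculant_row hn r w (v j) (hvn j) i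
    obtain ⟨U, hU⟩ := hdet
    have hM : rCirculant r w = U.val * Matrix.diagonal d * U⁻¹.val := by
      rw [hU, ← hmul, ← hU, mul_assoc, Units.mul_inv, mul_one]
    rw [hM, Matrix.coe_units_inv, Matrix.charpoly_units_conj, Matrix.charpoly_diagonal, Finset.prod_range]
end

section
/- Let K be a field and S an n×n matrix over K whose minimal polynomial is p(x)^r for some irreducible polynomial p(x) over K. Let R = K[S] be the commutative subalgebra of n×n matrices generated by S, and let A be an mn×mn matrix over K which, when partitioned into an m×m array of n×n blocks, has all blocks lying in R. If there exist k row-block indices and k column-block indices such that the k×k matrix over R formed by the corresponding blocks has determinant (computed in the commutative ring R) an invertible element of R, then rank_K(A) ≥ k·n. -/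
/-- Let `S` be an `n × n` matrix over a field `K` whose minimal polynomial
is `p ^ r` with `p` irreducible, and let `R = K[S]` be the commutative subalgebra generated
by `S` (its elements are the matrices `aeval S f` for polynomials `f`). Let `A` be an
`mn × mn` matrix whose `(i,j)` block (in the `m × m` array of `n × n` blocks) is
`aeval S (f i j) ∈ R`. If one can choose `k` row-block indices and `k` column-block
indices such that the determinant of the corresponding `k × k` matrix of blocks, computed
in the commutative ring `R` (equivalently, as `aeval S` of the determinant of the
corresponding matrix of polynomials), is an invertible element of `R`, then
`rank_K A ≥ k * n`. -/
theorem rank_ge_of_unit_block_det {K : Type*} [Field K] {n m k r : ℕ}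
    (S : Matrix (Fin n) (Fin n) K) (p : Polynomial K)
    (hp : Irreducible p) (hmin : minpoly K S = p ^ r)
    (f : Fin m → Fin m → Polynomial K)
    (A : Matrix (Fin m × Fin n) (Fin m × Fin n) K)
    (hA : ∀ (i j : Fin m) (x y : Fin n),
      A (i, x) (j, y) = Polynomial.aeval S (f i j) x y)
    (row col : Fin k → Fin m)
    (hrow : Function.Injective row) (hcol : Function.Injective col)
    (hdet : ∃ g : Polynomial K,
      Polynomial.aeval S ((Matrix.of fun i j : Fin k => f (row i) (col j)).det * g) = 1) :
    k * n ≤ A.rank := by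
  obtain ⟨g, hg⟩ := hdet
  set P : Matrix (Fin k) (Fin k) (Polynomial K) :=
    Matrix.of fun i j : Fin k => f (row i) (col j) with hP
  let φ : Matrix (Fin k) (Fin k) (Polynomial K) →+* Matrix (Fin k × Fin n) (Fin k × Fin n) K :=
    (Matrix.compRingEquiv (Fin k) (Fin n) K : _ →+* _).comp
      (Polynomial.aeval S : Polynomial K →ₐ[K] _).toRingHom.mapMatrix
  have h1 : P * (g • P.adjugate) = Matrix.diagonal (fun _ => P.det * g) := by
    rw [Matrix.mul_smul, Matrix.mul_adjugate, smul_smul, mul_comm, Matrix.smul_one_eq_diagonal]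
  have h2 : φ P * φ (g • P.adjugate) = 1 := by
    rw [← map_mul, h1]
    have h3 : (Polynomial.aeval S : Polynomial K →ₐ[K] _).toRingHom.mapMatrix
        (Matrix.diagonal (fun _ : Fin k => P.det * g)) = 1 := by
      ext1 i j
      by_cases hij : i = j
      · subst hij
        simpa using hg
      · simp [hij]
    change Matrix.compRingEquiv (Fin k) (Fin n) K ((Polynomial.aeval S : Polynomial K →ₐ[K] _).toRingHom.mapMatrix
      (Matrix.diagonal (fun _ : Fin k => P.det * g))) = 1
    rw [h3]
    exact map_one (Matrix.compAlgEquiv (Fin k) (Fin n) K K)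
  have h4 : (φ P).rank = k * n := by
    rw [Matrix.rank_of_isUnit _ (IsUnit.of_mul_eq_one _ h2)]
    simp
  have h5 : φ P = A.submatrix (Prod.map row id) (Prod.map col id) := by
    ext ⟨i, x⟩ ⟨j, y⟩
    exact (hA (row i) (col j) x y).symm
  rw [← h4, h5]
  exact Matrix.rank_submatrix_le _ _ _
end

section
/- Let K be a field and N an n×n matrix over K whose characteristic polynomial and minimal polynomial both equal p(x)^r, where p(x) is irreducible over K of degree e (so n = r·e). Let Q(x) be a polynomial over K coprime to p(x). Then for every 0 ≤ j ≤ r, the matrix p(N)^j · Q(N) has rank (r − j)·e over K; in particular Q(N) is non-singular. -/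
open Polynomial in
/-- Lower bound on the rank of `p(N)^j`. -/
lemma rank_pow_lower {K : Type*} [Field K] {n r e : ℕ}
    (N : Matrix (Fin n) (Fin n) K) (p : Polynomial K)
    (hp : Irreducible p) (he : p.natDegree = e)
    (hmin : minpoly K N = p ^ r) (j : ℕ) (hj : j ≤ r) :
    (r - j) * e ≤ ((Polynomial.aeval N p) ^ j).rank := by
  rcases Nat.eq_zero_or_pos r with h0 | hr
  · simp [h0]
  have hzero : aeval N (p ^ r) = 0 := by rw [← hmin]; exact minpoly.aeval K N
  have hne : aeval N (p ^ (r - 1)) ≠ 0 := by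
    intro h
    have h1 := minpoly.dvd K N h
    rw [hmin, pow_dvd_pow_iff hp.ne_zero hp.not_isUnit] at h1
    omega
  obtain ⟨v, hv⟩ : ∃ v, (aeval N (p ^ (r - 1))).mulVec v ≠ 0 := by
    by_contra! h
    apply hne
    apply Matrix.mulVec_injective
    funext v
    rw [h v, Matrix.zero_mulVec]
  have key : ∀ g : K[X], (aeval N g).mulVec v = 0 → p ^ r ∣ g := by
    intro g hg
    classical
    obtain ⟨k, hk, hass⟩ := (dvd_prime_pow hp.prime r).1 (EuclideanDomain.gcd_dvd_right g (p ^ r))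
    rcases hk.lt_or_eq with hlt | rfl
    · exfalso
      apply hv
      have h1 : EuclideanDomain.gcd g (p ^ r) ∣ p ^ (r - 1) :=
        hass.dvd.trans (pow_dvd_pow p (by omega))
      obtain ⟨c, hc⟩ := h1
      rw [hc, EuclideanDomain.gcd_eq_gcd_ab g (p ^ r)]
      have : (g * EuclideanDomain.gcdA g (p ^ r) + p ^ r * EuclideanDomain.gcdB g (p ^ r)) * c
        = (EuclideanDomain.gcdA g (p ^ r) * c) * g
          + (EuclideanDomain.gcdB g (p ^ r) * c) * p ^ r := by ring
      rw [this, map_add, map_mul _ _ g, map_mul _ _ (p ^ r), hzero, mul_zero, add_zero,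
        ← Matrix.mulVec_mulVec, hg, Matrix.mulVec_zero]
    · exact hass.symm.dvd.trans (EuclideanDomain.gcd_dvd_left g _)
  let L : degreeLT K ((r - j) * e) →ₗ[K] (Fin n → K) :=
    { toFun := fun f => (aeval N (p ^ j * (f : K[X]))).mulVec v
      map_add' := by intro f g; simp [mul_add, Matrix.add_mulVec]
      map_smul' := by intro c f; simp [Matrix.smul_mulVec] }
  have hL : Function.Injective L := by
    rw [← LinearMap.ker_eq_bot, LinearMap.ker_eq_bot']
    rintro ⟨f, hf⟩ h
    have h1 : p ^ r ∣ p ^ j * f := key _ h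
    rw [← Nat.add_sub_of_le hj, pow_add, mul_dvd_mul_iff_left (pow_ne_zero _ hp.ne_zero)] at h1
    have : f = 0 := by
      apply eq_zero_of_dvd_of_degree_lt h1
      rw [degree_eq_natDegree (pow_ne_zero _ hp.ne_zero), natDegree_pow, he]
      exact mem_degreeLT.1 hf
    exact Subtype.ext this
  have h2 := LinearMap.finrank_range_of_inj hL
  rw [(degreeLTEquiv K _).finrank_eq, Module.finrank_fin_fun] at h2
  rw [← h2, Matrix.rank]
  apply Submodule.finrank_mono
  rintro _ ⟨f, rfl⟩
  refine ⟨(aeval N (f : K[X])).mulVec v, ?_⟩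
  simp [L, Matrix.mulVec_mulVec]

/-- Let `N` be an `n × n` matrix over a field `K` whose characteristic
and minimal polynomials both equal `p ^ r` with `p` irreducible of degree `e`
(so `n = r * e`), and let `Q` be a polynomial coprime to `p`. Then for every `j ≤ r`,
the matrix `p(N)^j * Q(N)` has rank `(r - j) * e`; in particular `Q(N)` is non-singular. -/
theorem rank_pow_mul_coprime_eval {K : Type*} [Field K] {n r e : ℕ}
    (N : Matrix (Fin n) (Fin n) K) (p Q : Polynomial K)
    (hp : Irreducible p) (he : p.natDegree = e)
    (hchar : N.charpoly = p ^ r) (hmin : minpoly K N = p ^ r)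
    (hn : n = r * e) (hQ : IsCoprime p Q) :
    (∀ j ≤ r, ((Polynomial.aeval N p) ^ j * Polynomial.aeval N Q).rank = (r - j) * e) ∧
      IsUnit (Polynomial.aeval N Q) := by
  have hzero : (Polynomial.aeval N p) ^ r = 0 := by
    rw [← map_pow, ← hmin]; exact minpoly.aeval K N
  have hU : IsUnit (Polynomial.aeval N Q) := by
    obtain ⟨a, b, hab⟩ := hQ.pow_left (m := r)
    have h := congrArg (Polynomial.aeval N) hab
    rw [map_add, map_mul, map_mul, map_pow, hzero, mul_zero, zero_add, map_one] at h
    exact IsUnit.of_mul_eq_one_right _ h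
  refine ⟨fun j hj => ?_, hU⟩
  rw [Matrix.rank_mul_eq_left_of_isUnit_det _ _ ((Matrix.isUnit_iff_isUnit_det _).1 hU)]
  have h1 := rank_pow_lower N p hp he hmin j hj
  have h2 := rank_pow_lower N p hp he hmin (r - j) (Nat.sub_le _ _)
  have h3 := Matrix.rank_add_rank_le_card_of_mul_eq_zero
    (A := (Polynomial.aeval N p) ^ j) (B := (Polynomial.aeval N p) ^ (r - j))
    (by rw [← pow_add, Nat.add_sub_of_le hj, hzero])
  rw [Fintype.card_fin] at h3
  rw [Nat.sub_sub_self hj] at h2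
  have h4 : n = (r - j) * e + j * e := by rw [← add_mul, Nat.sub_add_cancel hj, hn]
  omega
end

section
/- Let K be a field, b = (b_1, b_2, …) a sequence over K with period n, and a = (a_1, a_2, …) a sequence of positive integers. Set s_k = a_1 + ⋯ + a_k, suppose a has period m and gcd(s_m, n) = 1, and let v be an integer with v·s_m ≡ 1 (mod n). For t ≥ 1 define the subsequence C^t by C^t_i = b_{s_t + s_m·i} for i ≥ 0, and set l_t = v·(s_t − s_1). Then each C^t has period n and C^t is the cyclic shift of C^1 by l_t: for all i ≥ 0, C^t_i = C^1_{i + l_t} (where C^1 is extended by its period n). Equivalently, b_{s_t + s_m·i} = b_{s_1 + s_m·(i + v·(s_t − s_1))} for all t ≥ 1 and i ≥ 0. -/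
/-- Let `b` have period `n`, let `a` be a sequence of positive integers
of period `m` with partial sums `s`, with `gcd (s m) n = 1`, and let `v` be an inverse of
`s m` mod `n`. For `t ≥ 1` the subsequence `C^t` given by `C^t_i = b (s t + s m * i)` has
period `n`, and `C^t` is the cyclic shift of `C^1` by `l t = v * (s t - s 1)`:
`b (s t + s m * i) = b (s 1 + s m * (i + v * (s t - s 1)))` for all `t ≥ 1`, `i ≥ 0`. -/
theorem subsequences_are_shifts {K : Type*} [Field K] {n m : ℕ}
    (hn : 0 < n) (hm : 0 < m)
    (b : ℕ → K) (hb : ∀ t, 1 ≤ t → b (t + n) = b t)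
    (a : ℕ → ℕ) (ha : ∀ i, 1 ≤ i → 0 < a i) (haper : ∀ t, 1 ≤ t → a (t + m) = a t)
    (s : ℕ → ℕ) (hs : ∀ k, s k = ∑ i ∈ Finset.Icc 1 k, a i)
    (hcop : Nat.gcd (s m) n = 1)
    (v : ℕ) (hv : v * s m ≡ 1 [MOD n]) :
    (∀ t, 1 ≤ t → ∀ i : ℕ, b (s t + s m * (i + n)) = b (s t + s m * i)) ∧
    (∀ t, 1 ≤ t → ∀ i : ℕ, b (s t + s m * i) = b (s 1 + s m * (i + v * (s t - s 1)))) := by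
  have hmul : ∀ k x, 1 ≤ x → b (x + n * k) = b x := by
    intro k
    induction k with
    | zero => intro x _; simp
    | succ k ih =>
      intro x hx
      rw [Nat.mul_succ, ← Nat.add_assoc, hb _ (by omega), ih x hx]
  have hle : ∀ x y, 1 ≤ x → x ≤ y → x ≡ y [MOD n] → b x = b y := by
    intro x y hx hxy h
    obtain ⟨k, hk⟩ := (Nat.modEq_iff_dvd' hxy).1 h
    have : y = x + n * k := by omega
    rw [this, hmul k x hx]
  have hmod : ∀ x y, 1 ≤ x → 1 ≤ y → x ≡ y [MOD n] → b x = b y := by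
    intro x y hx hy h
    rcases le_total x y with hxy | hxy
    · exact hle x y hx hxy h
    · exact (hle y x hy hxy h.symm).symm
  have h1 : 1 ≤ s 1 := by
    have := ha 1 le_rfl
    rw [hs, Finset.Icc_self, Finset.sum_singleton]; omega
  have hmono : ∀ t, 1 ≤ t → s 1 ≤ s t := by
    intro t ht
    rw [hs, hs]
    exact Finset.sum_le_sum_of_subset (Finset.Icc_subset_Icc_right ht)
  refine ⟨fun t ht i => ?_, fun t ht i => ?_⟩
  · have e : s t + s m * (i + n) = s t + s m * i + n * s m := by ring
    rw [e]
    have := hmono t ht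
    exact hmul _ _ (by omega)
  · have h2 := hmono t ht
    refine hmod _ _ (by omega) (by omega) ?_
    obtain ⟨d, hd⟩ := Nat.exists_eq_add_of_le h2
    have e : s t - s 1 = d := by omega
    rw [e, hd]
    have h3 : s 1 + s m * i + (v * s m) * d ≡ s 1 + s m * i + 1 * d [MOD n] :=
      Nat.ModEq.add_left _ (hv.mul_right d)
    have e1 : s 1 + s m * (i + v * d) = s 1 + s m * i + (v * s m) * d := by ring
    have e2 : s 1 + d + s m * i = s 1 + s m * i + 1 * d := by ring
    rw [e1, e2]
    exact h3.symm
end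

section
/- Let b = (b_1, b_2, …) be a sequence over F_2 with period n, and a = (a_1, a_2, …) a sequence of positive integers with period m; set s_k = a_1 + ⋯ + a_k and assume gcd(s_m, n) = 1. Let C = (c_1, c_2, …) be the clock-controlled sequence c_t = b_{s_t}. Write n = 2^σ·n₀ with n₀ odd, so that over F_2 one has x^n − 1 = ∏_{t=1}^{d} p_t(x)^{2^σ} with p_1, …, p_d the distinct monic irreducible factors of x^{n₀} − 1. Let H(x) be the characteristic polynomial of the shortest linear recurrence of the sampled sequence C^1 = (c_1, c_{1+m}, c_{1+2m}, …) (so H divides x^n − 1), and write H(x) = ∏_{t=1}^{d} p_t(x)^{h_t}. Let v be an integer with v·s_m ≡ 1 (mod n). For each t, let F_t be the field F_2[x]/(p_t(x)), let α_t be the class of x in F_t (a unit), let β_t = α_t^v, let E_t(X) = Σ_{i=0}^{m−1} β_t^{s_{i+1}} X^i ∈ F_t[X], and let g_t = deg gcd(E_t(X), X^m − α_t^{−1}) in F_t[X]. Then the linear complexity of C over F_2 satisfies L(C) ≥ Σ_{t=1}^{d} h_t · deg(p_t) · (m − g_t). -/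
namespace ClockAux
open Polynomial

/-- The shift operator. -/
def shift (K : Type*) [Field K] : (ℕ → K) →ₗ[K] (ℕ → K) :=
  LinearMap.funLeft K K (fun t => t + 1)

lemma shift_pow {K : Type*} [Field K] (i : ℕ) (u : ℕ → K) (t : ℕ) :
    ((shift K) ^ i) u t = u (t + i) := by
  induction i generalizing t with
  | zero => simp
  | succ i ih =>
    rw [pow_succ', Module.End.mul_apply]
    show ((shift K) ^ i) u (t + 1) = _
    rw [ih]; congr 1; omega

lemma aeval_shift {K : Type*} [Field K] (q : K[X]) (u : ℕ → K) (t : ℕ) :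
    aeval (shift K) q u t = ∑ i ∈ Finset.range (q.natDegree + 1), q.coeff i * u (t + i) := by
  rw [aeval_eq_sum_range]
  simp [LinearMap.sum_apply, Finset.sum_apply, shift_pow]

lemma aeval_shift_tr {K : Type*} [Field K] (q : K[X]) (u : ℕ → K) (t e : ℕ) :
    aeval (shift K) q (fun i => u (i + e)) t = aeval (shift K) q u (t + e) := by
  rw [aeval_shift, aeval_shift]
  refine Finset.sum_congr rfl fun i _ => ?_
  congr 2; omega

lemma aeval_X_pow_shift {K : Type*} [Field K] (u : ℕ → K) (t e : ℕ) :
    aeval (shift K) (X ^ e : K[X]) u t = u (t + e) := by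
  rw [map_pow, aeval_X, shift_pow]

/-- Spread a sequence with zeros. -/
def spread {K : Type*} [Field K] (m : ℕ) (u : ℕ → K) : ℕ → K :=
  fun l => if m ∣ l then u (l / m) else 0

lemma aeval_expand_spread {K : Type*} [Field K] (m : ℕ) (hm : 0 < m) (q : K[X]) (u : ℕ → K) :
    aeval (shift K) (expand K m q) (spread m u) = spread m (aeval (shift K) q u) := by
  induction q using Polynomial.induction_on' with
  | add p q hp hq =>
    simp only [map_add, LinearMap.add_apply, hp, hq]
    funext l; simp only [spread, Pi.add_apply]; split_ifs <;> simp
  | monomial e a =>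
    rw [← C_mul_X_pow_eq_monomial]
    simp only [map_mul, map_pow, expand_C, expand_X, aeval_C]
    funext l
    simp only [← map_pow, ← pow_mul, Module.End.mul_apply, Module.algebraMap_end_apply,
      Pi.smul_apply, aeval_X_pow_shift, spread, smul_eq_mul, aeval_X, shift_pow]
    rw [Nat.add_mul_div_left _ _ hm]
    simp only [Nat.dvd_add_left (Dvd.intro e rfl : m ∣ m * e)]
    split_ifs <;> simp

lemma exists_decomp {K : Type*} [Field K] (m : ℕ) (hm : 0 < m) (Q : K[X]) :
    ∃ q : ℕ → K[X], Q = ∑ j ∈ Finset.range m, X ^ j * expand K m (q j) := by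
  induction Q using Polynomial.induction_on' with
  | add p q hp hq =>
    obtain ⟨f, hf⟩ := hp
    obtain ⟨g, hg⟩ := hq
    refine ⟨fun j => f j + g j, ?_⟩
    simp only [map_add, mul_add, Finset.sum_add_distrib, ← hf, ← hg]
  | monomial e a =>
    refine ⟨fun j => if j = e % m then C a * X ^ (e / m) else 0, ?_⟩
    rw [Finset.sum_eq_single (e % m)]
    · simp only [if_true, map_mul, map_pow, expand_C, expand_X]
      rw [← C_mul_X_pow_eq_monomial, ← pow_mul, mul_left_comm, ← pow_add, Nat.mod_add_div]
    · intro j _ hj; simp [hj]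
    · intro hh; exact absurd (Finset.mem_range.2 (Nat.mod_lt _ hm)) hh

lemma rec_of_monic {K : Type*} [Field K] (a : ℕ → K) (q : K[X]) (hq : q.Monic)
    (h : aeval (shift K) q (fun i => a (i + 1)) = 0) : IsLinearRecurrence a q.natDegree := by
  refine ⟨fun i => - q.coeff (q.natDegree - 1 - i), fun t ht => ?_⟩
  have h1 := congrFun h (t - 1)
  rw [aeval_shift, Finset.sum_range_succ, ← Finset.sum_range_reflect] at h1
  rw [hq.coeff_natDegree, one_mul, Pi.zero_apply] at h1
  rw [show t + q.natDegree = t - 1 + q.natDegree + 1 by omega, eq_neg_of_add_eq_zero_right h1]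
  rw [Finset.sum_range, ← Finset.sum_neg_distrib]
  refine Finset.sum_congr rfl fun i _ => ?_
  have := i.2
  rw [neg_mul]
  congr 3; omega

lemma exists_monic {K : Type*} [Field K] (a : ℕ → K) (L : ℕ) (h : IsLinearRecurrence a L) :
    ∃ q : K[X], q ≠ 0 ∧ q.natDegree = L ∧ aeval (shift K) q (fun i => a (i + 1)) = 0 := by
  obtain ⟨lam, hl⟩ := h
  have hdeg : (∑ i : Fin L, C (lam i) * X ^ (L - 1 - (i : ℕ)) : K[X]).degree < L := by
    refine lt_of_le_of_lt (degree_sum_le _ _) ?_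
    rw [Finset.sup_lt_iff (WithBot.bot_lt_coe _)]
    intro i _
    refine lt_of_le_of_lt (degree_C_mul_X_pow_le _ _) ?_
    have := i.2
    exact_mod_cast (by omega : L - 1 - (i : ℕ) < L)
  have hmon := monic_X_pow_sub (n := L) hdeg
  refine ⟨_, hmon.ne_zero, ?_, ?_⟩
  · exact natDegree_eq_of_degree_eq_some (by
      rw [degree_sub_eq_left_of_degree_lt] <;> simpa using hdeg)
  · funext t
    rw [map_sub, LinearMap.sub_apply, Pi.sub_apply, aeval_X_pow_shift]
    have := hl (t + 1) (by omega)
    rw [show t + L + 1 = t + 1 + L by omega, this]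
    simp only [map_sum, map_mul, aeval_C, LinearMap.sum_apply, Module.End.mul_apply,
      Finset.sum_apply, Module.algebraMap_end_apply, Pi.smul_apply, smul_eq_mul,
      aeval_X_pow_shift, Pi.zero_apply]
    rw [sub_eq_zero]
    refine Finset.sum_congr rfl fun i _ => ?_
    have := i.2
    congr 2; omega

/-- minimality -/
lemma dvd_of_annihilates {K : Type*} [Field K] (a : ℕ → K) (H : K[X]) (hH : H.Monic)
    (hdeg : H.natDegree = linComplexity a) (hann : aeval (shift K) H (fun i => a (i + 1)) = 0)
    (q : K[X]) (hq : aeval (shift K) q (fun i => a (i + 1)) = 0) : H ∣ q := by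
  by_contra hnd
  have hr : q %ₘ H ≠ 0 := fun h0 => hnd ((modByMonic_eq_zero_iff_dvd hH).1 h0)
  have hra : aeval (shift K) (q %ₘ H) (fun i => a (i + 1)) = 0 := by
    rw [modByMonic_eq_sub_mul_div q H, map_sub, mul_comm, map_mul, LinearMap.sub_apply,
      Module.End.mul_apply, hann, hq]; simp
  have hmon := monic_mul_leadingCoeff_inv hr
  have h2 := rec_of_monic a _ hmon (by
    rw [mul_comm, map_mul, Module.End.mul_apply, hra, map_zero])
  have h3 : linComplexity a ≤ _ := Nat.sInf_le h2
  rw [natDegree_mul_leadingCoeff_inv _ hr] at h3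
  have h4 : H ≠ 1 := fun h1 => hnd (h1 ▸ one_dvd _)
  have := natDegree_modByMonic_lt q hH h4
  omega

/-- divisibility of annihilators of the spread sequence -/
lemma expand_dvd {K : Type*} [Field K] (m : ℕ) (hm : 0 < m) (H : K[X]) (u : ℕ → K)
    (hmin : ∀ q : K[X], (∀ k, aeval (shift K) q u (k + 1) = 0) → H ∣ q)
    (Q : K[X]) (hQ : aeval (shift K) Q (spread m u) = 0) : expand K m H ∣ Q := by
  obtain ⟨q, rfl⟩ := exists_decomp m hm Q
  refine Finset.dvd_sum fun j hj => Dvd.dvd.mul_left ?_ _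
  have hj' := Finset.mem_range.1 hj
  suffices H ∣ q j by
    obtain ⟨r, hr⟩ := this
    exact ⟨expand K m r, by rw [hr, map_mul]⟩
  refine hmin _ fun k => ?_
  have h1 := congrFun hQ (m * k + (m - j))
  rw [map_sum, LinearMap.sum_apply, Finset.sum_apply, Finset.sum_eq_single j] at h1
  · rw [map_mul, Module.End.mul_apply, aeval_expand_spread m hm, aeval_X_pow_shift,
      show m * k + (m - j) + j = m * (k + 1) by rw [mul_add]; omega] at h1
    simpa [spread, hm] using h1
  · intro i hi hij
    have hi' := Finset.mem_range.1 hi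
    rw [map_mul, Module.End.mul_apply, aeval_expand_spread m hm, aeval_X_pow_shift, spread,
      if_neg]
    rintro ⟨e, he⟩
    have h5 : m * k + m + i = m * e + j := by omega
    have h6 := congrArg (· % m) h5
    simp [Nat.add_mod, Nat.mod_eq_of_lt hi', Nat.mod_eq_of_lt hj'] at h6
    exact hij h6
  · exact fun hh => absurd hj hh

lemma gcd_prod_dvd {R ι : Type*} [CommRing R] [IsDomain R] [GCDMonoid R] (S : Finset ι)
    (f : ι → R) (h : ι → ℕ) (E : R) :
    gcd E (∏ t ∈ S, f t ^ h t) ∣ ∏ t ∈ S, gcd E (f t) ^ h t := by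
  classical
  induction S using Finset.induction_on with
  | empty => simp
  | insert a S ha ih =>
    rw [Finset.prod_insert ha, Finset.prod_insert ha]
    refine (gcd_mul_dvd_mul_gcd _ _ _).trans (mul_dvd_mul ?_ ih)
    generalize h a = k
    induction k with
    | zero => simp
    | succ k ihk =>
      rw [pow_succ, pow_succ]
      exact (gcd_mul_dvd_mul_gcd _ _ _).trans (mul_dvd_mul ihk dvd_rfl)

lemma degree_step {K ι : Type*} [Field K] [GCDMonoid K[X]] (S : Finset ι)
    (f : ι → K[X]) (hf : ∀ t, f t ≠ 0) (h : ι → ℕ) (E M : K[X]) (hM : M ≠ 0)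
    (hd : ∏ t ∈ S, f t ^ h t ∣ M * E) :
    ∑ t ∈ S, h t * (f t).natDegree ≤ M.natDegree + ∑ t ∈ S, h t * (gcd E (f t)).natDegree := by
  have h0 : ∀ t, gcd E (f t) ≠ 0 := fun t hh => hf t ((gcd_eq_zero_iff _ _).1 hh).2
  have h1 : ∏ t ∈ S, f t ^ h t ∣ M * ∏ t ∈ S, gcd E (f t) ^ h t :=
    ((dvd_gcd hd (dvd_mul_left _ _)).trans (gcd_mul_left' _ _ _).dvd).trans
      (mul_dvd_mul dvd_rfl (gcd_prod_dvd S f h E))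
  have h2 : (∏ t ∈ S, gcd E (f t) ^ h t) ≠ 0 :=
    Finset.prod_ne_zero_iff.2 fun t _ => pow_ne_zero _ (h0 t)
  have h3 := natDegree_le_of_dvd h1 (mul_ne_zero hM h2)
  rw [natDegree_mul hM h2, natDegree_prod _ _ fun t _ => pow_ne_zero _ (hf t),
    natDegree_prod _ _ fun t _ => pow_ne_zero _ (h0 t)] at h3
  simpa [natDegree_pow] using h3

lemma key {K : Type*} [Field K] (p : K[X]) [Fact (Irreducible p)] (m n : ℕ) (hm : 0 < m)
    (hn : 0 < n) (hpn : p ∣ X ^ n - 1) (w : ℕ → ℕ) (αinv : AdjoinRoot p)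
    (hα : AdjoinRoot.root p * αinv = 1) (D : (AdjoinRoot p)[X])
    (hD2 : D ∣ X ^ m - C αinv)
    (hD3 : ∀ D', D' ∣ (∑ i ∈ Finset.range m, C (AdjoinRoot.root p ^ w i) * X ^ i) →
      D' ∣ X ^ m - C αinv → D' ∣ D)
    (G : K[X]) (hG1 : G ∣ ∑ i ∈ Finset.range m, X ^ (m * (w i + n) - i))
    (hG2 : G ∣ expand K m p) :
    D.natDegree ≤ m ∧ G.natDegree ≤ p.natDegree * D.natDegree := by
  have hp0 : p ≠ 0 := (Fact.out : Irreducible p).ne_zero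
  have hX0 : (X ^ m - C αinv : (AdjoinRoot p)[X]) ≠ 0 := X_pow_sub_C_ne_zero hm _
  have hD0 : D ≠ 0 := fun h => hX0 (by rw [h] at hD2; exact zero_dvd_iff.1 hD2)
  have hG0 : G ≠ 0 := by
    rintro rfl
    exact hp0 ((expand_eq_zero hm).1 (zero_dvd_iff.1 hG2))
  refine ⟨(natDegree_le_of_dvd hD2 hX0).trans (natDegree_X_pow_sub_C).le, ?_⟩
  set y : AdjoinRoot G := AdjoinRoot.root G with hy
  have hroot : aeval (y ^ m) p = 0 := by
    rw [← expand_aeval]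
    rw [hy, AdjoinRoot.aeval_eq, AdjoinRoot.mk_eq_zero]; exact hG2
  have hyN : y ^ (m * n) = 1 := by
    obtain ⟨r, hr⟩ := hpn
    have := congrArg (aeval (y ^ m)) hr
    rw [map_mul, hroot, zero_mul] at this
    simp only [map_sub, map_pow, aeval_X, map_one, ← pow_mul] at this
    exact sub_eq_zero.1 this
  set z : AdjoinRoot G := y ^ (m * n - 1) with hz
  have hN : 0 < m * n := Nat.mul_pos hm hn
  have hyz : y * z = 1 := by
    rw [hz, ← pow_succ', Nat.sub_add_cancel hN, hyN]
  let φ : AdjoinRoot p →ₐ[K] AdjoinRoot G :=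
    AdjoinRoot.liftAlgHom p (Algebra.ofId K _) (y ^ m) hroot
  have hφ : φ (AdjoinRoot.root p) = y ^ m := AdjoinRoot.liftAlgHom_root _ _ _ _
  have hφinv : φ αinv = z ^ m := by
    have h1 := congrArg φ hα
    rw [map_mul, hφ, map_one] at h1
    calc φ αinv = (y * z) ^ m * φ αinv := by rw [hyz]; simp
      _ = z ^ m * (y ^ m * φ αinv) := by ring
      _ = _ := by rw [h1, mul_one]
  have hE : eval₂ (φ : AdjoinRoot p →+* AdjoinRoot G) z
      (∑ i ∈ Finset.range m, C (AdjoinRoot.root p ^ w i) * X ^ i) = 0 := by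
    have h1 : aeval y (∑ i ∈ Finset.range m, X ^ (m * (w i + n) - i) : K[X]) = 0 := by
      rw [hy, AdjoinRoot.aeval_eq, AdjoinRoot.mk_eq_zero]; exact hG1
    rw [← h1, eval₂_finsetSum, map_sum]
    refine Finset.sum_congr rfl fun i hi => ?_
    have hi' := Finset.mem_range.1 hi
    have hle : i ≤ m * (w i + n) := by nlinarith
    rw [eval₂_mul, eval₂_C, eval₂_X_pow, map_pow, map_pow, aeval_X]
    rw [RingHom.coe_coe, hφ]
    calc (y ^ m) ^ w i * z ^ i = (y ^ m) ^ w i * y ^ (m * n) * z ^ i := by rw [hyN, mul_one]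
      _ = y ^ (m * (w i + n)) * z ^ i := by ring
      _ = y ^ (m * (w i + n) - i) * (y * z) ^ i := by
        rw [mul_pow, ← mul_assoc, ← pow_add, Nat.sub_add_cancel hle]
      _ = _ := by rw [hyz]; simp
  have hDz : eval₂ (φ : AdjoinRoot p →+* AdjoinRoot G) z D = 0 := by
    have hdvd := hD3 _ (EuclideanDomain.gcd_dvd_left _ _) (EuclideanDomain.gcd_dvd_right _ _)
    have hgcd := EuclideanDomain.gcd_eq_gcd_ab
      (∑ i ∈ Finset.range m, C (AdjoinRoot.root p ^ w i) * X ^ i) (X ^ m - C αinv)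
    have h0 : eval₂ (φ : AdjoinRoot p →+* AdjoinRoot G) z (X ^ m - C αinv) = 0 := by
      rw [eval₂_sub, eval₂_X_pow, eval₂_C, RingHom.coe_coe, hφinv, sub_self]
    have h1 := congrArg (eval₂ (φ : AdjoinRoot p →+* AdjoinRoot G) z) hgcd
    rw [eval₂_add, eval₂_mul, eval₂_mul, hE, h0, zero_mul, zero_mul, add_zero] at h1
    obtain ⟨r, hr⟩ := hdvd
    rw [hr, eval₂_mul, h1, zero_mul]
  let ψ : AdjoinRoot D →+* AdjoinRoot G :=
    AdjoinRoot.lift (φ : AdjoinRoot p →+* AdjoinRoot G) z hDz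
  let ψ' : AdjoinRoot D →ₐ[K] AdjoinRoot G :=
    { ψ with
      commutes' := fun r => by
        show ψ (algebraMap K (AdjoinRoot D) r) = _
        rw [IsScalarTower.algebraMap_apply K (AdjoinRoot p) (AdjoinRoot D)]
        show ψ (AdjoinRoot.of D _) = _
        rw [AdjoinRoot.lift_of]
        exact φ.commutes r }
  have hsurj : Function.Surjective ψ' := by
    rw [← AlgHom.range_eq_top, ← top_le_iff, ← AdjoinRoot.adjoinRoot_eq_top,
      Algebra.adjoin_le_iff, Set.singleton_subset_iff]
    refine ⟨AdjoinRoot.of D (AdjoinRoot.root p) * AdjoinRoot.root D ^ (m - 1), ?_⟩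
    show ψ _ = y
    rw [map_mul, map_pow, AdjoinRoot.lift_of, AdjoinRoot.lift_root, RingHom.coe_coe, hφ]
    obtain ⟨k, rfl⟩ : ∃ k, m = k + 1 := ⟨m - 1, by omega⟩
    calc y ^ (k + 1) * z ^ k = y * (y * z) ^ k := by ring
      _ = y := by rw [hyz]; simp
  have f1 : Module.finrank K (AdjoinRoot G) = G.natDegree := by
    rw [(AdjoinRoot.powerBasis hG0).finrank, AdjoinRoot.powerBasis_dim]
  have f2 : Module.finrank K (AdjoinRoot p) = p.natDegree := by
    rw [(AdjoinRoot.powerBasis hp0).finrank, AdjoinRoot.powerBasis_dim]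
  have f3 : Module.finrank (AdjoinRoot p) (AdjoinRoot D) = D.natDegree := by
    rw [(AdjoinRoot.powerBasis hD0).finrank, AdjoinRoot.powerBasis_dim]
  have : Module.Finite K (AdjoinRoot p) := (AdjoinRoot.powerBasis hp0).finite
  have : Module.Finite (AdjoinRoot p) (AdjoinRoot D) := (AdjoinRoot.powerBasis hD0).finite
  have : Module.Finite K (AdjoinRoot D) := Module.Finite.trans (AdjoinRoot p) _
  rw [← f1, ← f2, ← f3, Module.finrank_mul_finrank]
  exact LinearMap.finrank_le_finrank_of_surjective (f := ψ'.toLinearMap) hsurj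

end ClockAux

/-- **main lower bound.** Let `b` be a binary sequence of period `n`,
`a` a positive-integer control sequence of period `m` with partial sums `s` and
`gcd (s m) n = 1`, and `c t = b (s t)` the clock-controlled sequence. Write
`n = 2^σ * n₀` with `n₀` odd, and `X^n - 1 = ∏ t, (p t)^(2^σ)` over `F₂` with the `p t`
distinct monic irreducible. Let `H = ∏ t, (p t)^(h t)` be the characteristic polynomial
of the shortest linear recurrence of the sampled sequence `C¹ = (c 1, c (1+m), …)`,
let `v` be an inverse of `s m` mod `n`, and for each `t`, in `F_t = F₂[x]/(p t)`, let
`α t` be the class of `x`, `β t = (α t)^v`, `E_t(X) = Σ_{i<m} (β t)^(s (i+1)) Xⁱ`, and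
`g t = deg gcd (E_t(X), X^m - (α t)⁻¹)`.  Then
`L(c) ≥ Σ t, h t * deg (p t) * (m - g t)`. -/
theorem linComplexity_clockControlled_lower_bound
    (n m σ n₀ d : ℕ) (hn : 0 < n) (hm : 0 < m) (hodd : Odd n₀) (hnfac : n = 2 ^ σ * n₀)
    (b : ℕ → ZMod 2) (hb : ∀ t, 1 ≤ t → b (t + n) = b t)
    (a : ℕ → ℕ) (ha : ∀ i, 1 ≤ i → 0 < a i) (haper : ∀ t, 1 ≤ t → a (t + m) = a t)
    (s : ℕ → ℕ) (hs : ∀ k, s k = ∑ i ∈ Finset.Icc 1 k, a i)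
    (hcop : Nat.gcd (s m) n = 1)
    (c : ℕ → ZMod 2) (hc : ∀ t, 1 ≤ t → c t = b (s t))
    (p : Fin d → Polynomial (ZMod 2))
    (hpmonic : ∀ t, (p t).Monic) (hpirr : ∀ t, Irreducible (p t))
    (hpdist : Function.Injective p)
    (hfac : ∏ t, p t ^ 2 ^ σ = Polynomial.X ^ n - 1)
    (C1 : ℕ → ZMod 2) (hC1 : ∀ i, 1 ≤ i → C1 i = c (1 + m * (i - 1)))
    (H : Polynomial (ZMod 2)) (hHmonic : H.Monic)
    (hHdeg : H.natDegree = linComplexity C1)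
    (hHrec : ∀ t, 1 ≤ t →
      ∑ i ∈ Finset.range (H.natDegree + 1), H.coeff i * C1 (t + i) = 0)
    (h : Fin d → ℕ) (hHfac : H = ∏ t, p t ^ h t)
    (v : ℕ) (hv : v * s m ≡ 1 [MOD n])
    (g : Fin d → ℕ)
    (hg : ∀ t : Fin d,
      ∃ (αinv : Polynomial (ZMod 2) ⧸ Ideal.span {p t})
        (D : Polynomial (Polynomial (ZMod 2) ⧸ Ideal.span {p t})),
        Ideal.Quotient.mk (Ideal.span {p t}) Polynomial.X * αinv = 1 ∧
        D ∣ (∑ i ∈ Finset.range m,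
          Polynomial.C ((Ideal.Quotient.mk (Ideal.span {p t}) Polynomial.X) ^ (v * s (i + 1))) *
            Polynomial.X ^ i) ∧
        D ∣ (Polynomial.X ^ m - Polynomial.C αinv) ∧
        (∀ D', D' ∣ (∑ i ∈ Finset.range m,
          Polynomial.C ((Ideal.Quotient.mk (Ideal.span {p t}) Polynomial.X) ^ (v * s (i + 1))) *
            Polynomial.X ^ i) → D' ∣ (Polynomial.X ^ m - Polynomial.C αinv) → D' ∣ D) ∧
        D.natDegree = g t) :
    ∑ t, h t * (p t).natDegree * (m - g t) ≤ linComplexity c := by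
  classical
  have s0 : s 0 = 0 := by simp [hs]
  have ssucc : ∀ k, s (k + 1) = s k + a (k + 1) := fun k => by
    rw [hs, hs, Finset.sum_Icc_succ_top (by omega)]
  have sadd : ∀ k, s (k + m) = s k + s m := by
    intro k
    induction k with
    | zero => simp [s0]
    | succ k ih =>
      rw [show k + 1 + m = k + m + 1 by omega, ssucc, ih, ssucc,
        show k + m + 1 = k + 1 + m by omega, haper _ (by omega)]
      omega
  have saddmul : ∀ i k, s (i + m * k) = s i + k * s m := by
    intro i k
    induction k with
    | zero => simp
    | succ k ih => rw [mul_add, mul_one, ← add_assoc, sadd, ih]; ring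
  have spos : ∀ k, 1 ≤ s (k + 1) := fun k => by
    have := ha (k + 1) (by omega)
    rw [ssucc]; omega
  have bmul : ∀ k t, 1 ≤ t → b (t + n * k) = b t := by
    intro k t ht
    induction k with
    | zero => simp
    | succ k ih => rw [mul_add, mul_one, ← add_assoc, hb _ (by omega), ih]
  have bmod : ∀ t t', 1 ≤ t → 1 ≤ t' → t ≡ t' [MOD n] → b t = b t' := by
    have key : ∀ t t', 1 ≤ t → t ≤ t' → t ≡ t' [MOD n] → b t = b t' := by
      intro t t' ht hle hmod
      obtain ⟨k, hk⟩ := (Nat.modEq_iff_dvd' hle).1 hmod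
      rw [show t' = t + n * k by omega, bmul _ _ ht]
    intro t t' ht ht' hmod
    rcases le_total t t' with hle | hle
    · exact key _ _ ht hle hmod
    · exact (key _ _ ht' hle hmod.symm).symm
  let u : ℕ → ZMod 2 := fun k => b (n + k * s m)
  have hu : ∀ i k, u (k + (v * s (i + 1) + n)) = c (i + 1 + m * k) := by
    intro i k
    rw [hc _ (by omega), saddmul]
    have := spos i
    refine bmod _ _ (by omega) (by omega) ?_
    have h1 : n + (k + (v * s (i + 1) + n)) * s m
        = s (i + 1) * (v * s m) + k * s m + n * (1 + s m) := by ring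
    rw [h1]
    have h2 : s (i + 1) * (v * s m) + k * s m + n * (1 + s m) ≡
        s (i + 1) * 1 + k * s m + 0 [MOD n] :=
      ((hv.mul_left _).add_right _).add ((Nat.modEq_zero_iff_dvd).2 (dvd_mul_right _ _))
    simpa using h2
  have hC1u : (fun i => C1 (i + 1)) = fun i => u (i + (v * s (0 + 1) + n)) := by
    funext i
    rw [hC1 _ (by omega), hu]
    congr 1
  have hHann : Polynomial.aeval (ClockAux.shift (ZMod 2)) H (fun i => C1 (i + 1)) = 0 := by
    funext t
    rw [ClockAux.aeval_shift]
    have := hHrec (t + 1) (by omega)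
    rw [Pi.zero_apply, ← this]
    refine Finset.sum_congr rfl fun i _ => ?_
    congr 2; omega
  have hmin : ∀ q : Polynomial (ZMod 2),
      (∀ k, Polynomial.aeval (ClockAux.shift (ZMod 2)) q u (k + 1) = 0) → H ∣ q := by
    intro q hq
    refine ClockAux.dvd_of_annihilates C1 H hHmonic hHdeg hHann q ?_
    rw [hC1u]
    funext t
    rw [ClockAux.aeval_shift_tr]
    have := hq (t + (v * s (0 + 1) + n) - 1)
    rwa [Nat.sub_add_cancel (by omega)] at this
  let E : Polynomial (ZMod 2) :=
    ∑ i ∈ Finset.range m, Polynomial.X ^ (m * (v * s (i + 1) + n) - i)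
  have hcE : (fun i => c (i + 1)) =
      Polynomial.aeval (ClockAux.shift (ZMod 2)) E (ClockAux.spread m u) := by
    funext t
    have hj : t % m < m := Nat.mod_lt _ hm
    have ht := Nat.mod_add_div t m
    have hle : ∀ i, i < m → i ≤ m * (v * s (i + 1) + n) := fun i hi =>
      hi.le.trans (Nat.le_mul_of_pos_right m (by omega))
    rw [map_sum, LinearMap.sum_apply, Finset.sum_apply, Finset.sum_eq_single (t % m)]
    · have := hle _ hj
      rw [ClockAux.aeval_X_pow_shift, ClockAux.spread,
        show t + (m * (v * s (t % m + 1) + n) - t % m) =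
          m * (t / m + (v * s (t % m + 1) + n)) by rw [mul_add m (t / m)]; omega,
        if_pos (dvd_mul_right _ _), Nat.mul_div_cancel_left _ hm, hu]
      congr 1; omega
    · intro i hi hit
      have hi' := Finset.mem_range.1 hi
      have := hle _ hi'
      rw [ClockAux.aeval_X_pow_shift, ClockAux.spread, if_neg]
      rintro ⟨e, he⟩
      have h5 : t + m * (v * s (i + 1) + n) = m * e + i := by omega
      have h6 := congrArg (· % m) h5
      simp [Nat.add_mod, Nat.mod_eq_of_lt hi'] at h6
      exact hit h6.symm
    · exact fun hh => absurd (Finset.mem_range.2 hj) hh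
  have hne : {L | IsLinearRecurrence c L}.Nonempty := by
    refine ⟨_, ClockAux.rec_of_monic c (Polynomial.X ^ (m * n) - Polynomial.C 1)
      (Polynomial.monic_X_pow_sub_C _ (Nat.mul_pos hm hn).ne') ?_⟩
    funext t
    rw [map_sub, LinearMap.sub_apply, Pi.sub_apply, ClockAux.aeval_X_pow_shift, map_one, map_one,
      Module.End.one_apply, Pi.zero_apply, sub_eq_zero, hc _ (by omega), hc _ (by omega),
      show t + m * n + 1 = t + 1 + m * n by omega, saddmul, bmul _ _ (spos t)]
  obtain ⟨M, hM0, hMdeg, hMann⟩ := ClockAux.exists_monic c _ (Nat.sInf_mem hne)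
  have hdvd : Polynomial.expand (ZMod 2) m H ∣ M * E := by
    refine ClockAux.expand_dvd m hm H u hmin _ ?_
    rw [map_mul, Module.End.mul_apply, ← hcE, hMann]
  rw [hHfac, map_prod] at hdvd
  simp only [map_pow] at hdvd
  letI : GCDMonoid (Polynomial (ZMod 2)) := EuclideanDomain.gcdMonoid _
  have hmain := ClockAux.degree_step Finset.univ
    (fun t => Polynomial.expand (ZMod 2) m (p t))
    (fun t => (Polynomial.expand_ne_zero hm).2 (hpirr t).ne_zero) h E M hM0 hdvd
  have hkey : ∀ t, g t ≤ m ∧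
      (gcd E (Polynomial.expand (ZMod 2) m (p t))).natDegree ≤ (p t).natDegree * g t := by
    intro t
    obtain ⟨αinv, D, h1, h2, h3, h4, h5⟩ := hg t
    have : Fact (Irreducible (p t)) := ⟨hpirr t⟩
    have hpn : p t ∣ Polynomial.X ^ n - 1 := by
      rw [← hfac]
      exact (dvd_pow_self _ (by positivity)).trans
        (Finset.dvd_prod_of_mem (fun t => p t ^ 2 ^ σ) (Finset.mem_univ t))
    rw [← h5]
    exact ClockAux.key (p t) m n hm hn hpn (fun i => v * s (i + 1)) αinv h1 D h3 h4
      (gcd E (Polynomial.expand (ZMod 2) m (p t))) (gcd_dvd_left _ _) (gcd_dvd_right _ _)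
  have hL : linComplexity c = M.natDegree := hMdeg.symm
  rw [hL]
  have h1 : ∑ t, h t * (p t).natDegree * (m - g t) +
      ∑ t, h t * (gcd E (Polynomial.expand (ZMod 2) m (p t))).natDegree ≤
      ∑ t, h t * (Polynomial.expand (ZMod 2) m (p t)).natDegree := by
    rw [← Finset.sum_add_distrib]
    refine Finset.sum_le_sum fun t _ => ?_
    obtain ⟨hgm, hgd⟩ := hkey t
    obtain ⟨e, rfl⟩ := Nat.exists_eq_add_of_le hgm
    rw [Polynomial.natDegree_expand, Nat.add_sub_cancel_left]
    calc _ ≤ h t * (p t).natDegree * e + h t * ((p t).natDegree * g t) := by gcongr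
      _ = _ := by ring
  have h2 := h1.trans hmain
  omega
end

section
/- Let K be a field and S an n×n matrix over K whose minimal polynomial is p(x)^r for some monic irreducible polynomial p(x) over K. Let f_{ij}(x), 1 ≤ i, j ≤ m, be polynomials over K, and let A be the mn×mn matrix over K whose (i,j) block (in the m×m array of n×n blocks) is f_{ij}(S). Let Ā be the m×m matrix over the field K[x]/(p(x)) whose (i,j) entry is the class of f_{ij}(x) modulo p(x). Then rank_K(A) ≥ n · rank_{K[x]/(p(x))}(Ā). -/
lemma exists_mul_mul_eq_one_of_rank {F : Type*} [Field F] {m : ℕ} (B : Matrix (Fin m) (Fin m) F) :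
    ∃ (U : Matrix (Fin B.rank) (Fin m) F) (V : Matrix (Fin m) (Fin B.rank) F),
      U * B * V = 1 := by
  classical
  let b : Module.Basis (Fin B.rank) F (LinearMap.range B.mulVecLin) :=
    Module.finBasis F (LinearMap.range B.mulVecLin)
  choose v hv using fun j => (b j).2
  let V : Matrix (Fin m) (Fin B.rank) F := Matrix.of fun i j => v j i
  have hli : LinearIndependent F (B * V).col := by
    have h1 : (B * V).col = fun j => ((b j : LinearMap.range B.mulVecLin) : Fin m → F) := by
      funext j
      rw [← hv j]
      ext i
      simp [Matrix.mul_apply, Matrix.mulVec, dotProduct, V, Matrix.col]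
    rw [h1]
    exact b.linearIndependent.map' (Submodule.subtype _) (Submodule.ker_subtype _)
  have hinj : Function.Injective (B * V).mulVec := Matrix.mulVec_injective_iff.2 hli
  obtain ⟨g, hg⟩ := ((B * V).mulVecLin).exists_leftInverse_of_injective
    (LinearMap.ker_eq_bot.2 hinj)
  refine ⟨LinearMap.toMatrix' g, V, ?_⟩
  rw [Matrix.mul_assoc]
  have : LinearMap.toMatrix' (B * V).mulVecLin = B * V := LinearMap.toMatrix'_toLin' (B * V)
  rw [← this, ← LinearMap.toMatrix'_comp, hg, LinearMap.toMatrix'_id]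

lemma comp_mul_rect {K : Type*} [Field K] {a b c n : ℕ}
    (M : Matrix (Fin a) (Fin b) (Matrix (Fin n) (Fin n) K))
    (N : Matrix (Fin b) (Fin c) (Matrix (Fin n) (Fin n) K)) :
    Matrix.comp _ _ _ _ K (M * N) = Matrix.comp _ _ _ _ K M * Matrix.comp _ _ _ _ K N := by
  ext ⟨i, x⟩ ⟨j, y⟩
  simp [Matrix.comp_apply, Matrix.mul_apply, Fintype.sum_prod_type, Matrix.sum_apply]

/-- Let `S` be an `n × n` matrix over a field `K` with minimal
polynomial `p ^ r`, `p` monic irreducible, and let `A` be the `mn × mn` matrix whose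
`(i,j)` block is `f i j` evaluated at `S`. Let `Ā` be the `m × m` matrix over the field
`K[x]/(p)` whose `(i,j)` entry is the class of `f i j` mod `p`. Then
`rank_K A ≥ n * rank_{K[x]/(p)} Ā`. -/
theorem rank_ge_n_mul_residue_rank {K : Type*} [Field K] {n m r : ℕ}
    (S : Matrix (Fin n) (Fin n) K) (p : Polynomial K)
    (hpmonic : p.Monic) (hp : Irreducible p) (hmin : minpoly K S = p ^ r)
    (f : Fin m → Fin m → Polynomial K)
    (A : Matrix (Fin m × Fin n) (Fin m × Fin n) K)
    (hA : ∀ (i j : Fin m) (x y : Fin n),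
      A (i, x) (j, y) = Polynomial.aeval S (f i j) x y) :
    n * (Matrix.of fun i j : Fin m =>
          Ideal.Quotient.mk (Ideal.span {p}) (f i j)).rank ≤ A.rank := by
  classical
  haveI hmax : (Ideal.span {p}).IsMaximal :=
    PrincipalIdealRing.isMaximal_of_irreducible hp
  letI : Field (Polynomial K ⧸ Ideal.span {p}) := Ideal.Quotient.field _
  set q := Ideal.Quotient.mk (Ideal.span {p}) with hq
  have hqs : Function.Surjective q := Ideal.Quotient.mk_surjective
  set B := (Matrix.of fun i j : Fin m => q (f i j)) with hB
  obtain ⟨U, V, hUV⟩ := exists_mul_mul_eq_one_of_rank B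
  change n * B.rank ≤ A.rank
  generalize B.rank = k at U V hUV
  choose s hs using hqs
  let P : Matrix (Fin m) (Fin m) (Polynomial K) := Matrix.of f
  let Ul := U.map s
  let Vl := V.map s
  have hU : Ul.map q = U := by ext i j; simp [Ul, hs]
  have hV : Vl.map q = V := by ext i j; simp [Vl, hs]
  have hP : P.map q = B := by ext i j; simp [P, hB]
  have h1 : (Ul * P * Vl).map q = 1 := by
    rw [Matrix.map_mul, Matrix.map_mul, hU, hV, hP]; exact hUV
  have h2 : ∀ i j, ∃ w, (Ul * P * Vl) i j - (1 : Matrix (Fin k) (Fin k) (Polynomial K)) i j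
      = p * w := by
    intro i j
    have h3 : q ((Ul * P * Vl) i j) = (1 : Matrix (Fin k) (Fin k) _) i j := by
      rw [← h1]; rfl
    have h4 : q ((Ul * P * Vl) i j - (1 : Matrix (Fin k) (Fin k) (Polynomial K)) i j) = 0 := by
      rw [map_sub, h3, Matrix.one_apply, Matrix.one_apply]
      split_ifs <;> simp
    rw [hq, Ideal.Quotient.eq_zero_iff_mem, Ideal.mem_span_singleton] at h4
    exact h4
  choose w hw using h2
  let W : Matrix (Fin k) (Fin k) (Polynomial K) := Matrix.of w
  have h5 : Ul * P * Vl = 1 + p • W := by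
    ext1 i j
    rw [Matrix.add_apply, Matrix.smul_apply, smul_eq_mul]
    exact sub_eq_iff_eq_add'.1 (hw i j)
  let φ : Polynomial K →+* Matrix (Fin n) (Fin n) K := (Polynomial.aeval S : _ →ₐ[K] _)
  have hφ : φ (p ^ r) = 0 := by rw [← hmin]; exact minpoly.aeval K S
  let Φ : Matrix (Fin k) (Fin k) (Polynomial K) →+* Matrix (Fin k × Fin n) (Fin k × Fin n) K :=
    (Matrix.compRingEquiv (Fin k) (Fin n) K).toRingHom.comp φ.mapMatrix
  have hnil : IsNilpotent (Φ (p • W)) := by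
    refine ⟨r, ?_⟩
    rw [← map_pow, smul_pow]
    have : φ.mapMatrix (p ^ r • W ^ r) = 0 := by
      ext1 i j
      rw [RingHom.mapMatrix_apply, Matrix.map_apply, Matrix.smul_apply, smul_eq_mul, map_mul, hφ,
        zero_mul]; rfl
    change (Matrix.compRingEquiv (Fin k) (Fin n) K).toRingHom (φ.mapMatrix (p ^ r • W ^ r)) = 0
    rw [this, map_zero]
  have hunit : IsUnit (Φ (Ul * P * Vl)) := by
    rw [h5, map_add, map_one]; exact hnil.isUnit_one_add
  have hr := Matrix.rank_of_isUnit _ hunit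
  have hAP : Matrix.comp _ _ _ _ K (P.map φ) = A := by
    ext ⟨i, x⟩ ⟨j, y⟩
    rw [hA]; rfl
  have h6 : Φ (Ul * P * Vl) = Matrix.comp _ _ _ _ K (Ul.map φ) * A *
      Matrix.comp _ _ _ _ K (Vl.map φ) := by
    rw [← hAP, ← comp_mul_rect, ← comp_mul_rect, ← Matrix.map_mul, ← Matrix.map_mul]; rfl
  rw [h6] at hr
  have h7 := (Matrix.rank_mul_le_left (Matrix.comp _ _ _ _ K (Ul.map φ) * A)
      (Matrix.comp _ _ _ _ K (Vl.map φ))).trans (Matrix.rank_mul_le_right _ _)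
  rw [hr] at h7
  simpa [mul_comm] using h7
end

section
/- Let p be a prime such that q = 2p + 1 is also prime, with 2^88 ≤ q < 2^89 (so ⌊log₂ q⌋ = 89), 2 a primitive root modulo q, 2 a primitive root modulo p, and gcd(p − 1, 39) = 1. Fix an integer A with 1 ≤ A ≤ q − 1 and define the FCSR (ℓ-)sequence b over F_2 by letting b_i be the parity of the representative in {0, 1, …, q − 1} of A·2^{−i} modulo q; set n = 2p, which is a period of b. Let m = 2^39 − 1 and let a = (a_1, a_2, …) be a sequence of integers with 1 ≤ a_i ≤ 4 of period m such that s_m = 5·2^38 − 1, where s_j = a_1 + ⋯ + a_j (note gcd(s_m, n) = 1). Let C = (c_1, c_2, …) be the clock-controlled keystream c_t = b_{s_t}. Assume further (as follows from the theory of FCSR sequences) that the characteristic polynomial of the shortest linear recurrence of the decimated sequence (b_{s_1 + s_m·i})_{i ≥ 0} over F_2 equals (x + 1)(x^p + 1). Then the linear complexity of C over F_2 satisfies L(C) ≥ (p − 1)·(2^39 − 1) + 2. -/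
namespace Lifi

open Polynomial

theorem exists_pow_eq {p k : ℕ} [Fact p.Prime] (h2 : orderOf (2 : ZMod p) = p - 1)
    (hk : Nat.Coprime (p - 1) k) (u : ZMod p) (hu : u ≠ 0) : ∃ n : ℕ, u = (2 ^ k) ^ n := by
  have hp : p.Prime := Fact.out
  have hp2 : (2 : ZMod p) ≠ 0 := by
    intro h
    rw [h] at h2
    have h3 : p - 1 ≠ 0 := by have := hp.two_le; omega
    have h4 := pow_orderOf_eq_one (0 : ZMod p)
    rw [h2, zero_pow h3] at h4
    exact zero_ne_one h4
  let w : (ZMod p)ˣ := (Units.mk0 2 hp2) ^ k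
  have hw : orderOf w = p - 1 := by
    have h5 : orderOf (Units.mk0 (2 : ZMod p) hp2) = p - 1 := by
      rw [← orderOf_units]; simpa using h2
    have : orderOf w = orderOf (Units.mk0 (2 : ZMod p) hp2) := Nat.Coprime.orderOf_pow (by rw [h5]; exact hk)
    rw [this, h5]
  have hall : ∀ x : (ZMod p)ˣ, x ∈ Subgroup.zpowers w := by
    have htop : Subgroup.zpowers w = ⊤ := by
      apply Subgroup.eq_top_of_card_eq
      rw [Nat.card_zpowers, hw, Nat.card_eq_fintype_card, ZMod.card_units]
    intro x
    rw [htop]; trivial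
  have := hall (Units.mk0 u hu)
  rw [← mem_powers_iff_mem_zpowers] at this
  obtain ⟨n, hn⟩ := this
  refine ⟨n, ?_⟩
  have := congrArg Units.val hn
  simpa [w] using this.symm

theorem all_eq_of_sum {p k : ℕ} [Fact p.Prime] (h2 : orderOf (2 : ZMod p) = p - 1)
    (hk : Nat.Coprime (p - 1) k) {Ω : Type*} [Field Ω] [CharP Ω 2] (hodd : (p : Ω) ≠ 0)
    (ψ : AddChar (ZMod p) Ω) (hψ : ψ.IsPrimitive)
    (z : ZMod p → Ω) (hz : ∀ j, z j ^ 2 ^ k = z j)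
    (h0 : ∑ j, z j * ψ j = 0) (x y : ZMod p) : z x = z y := by
  have step : ∀ n : ℕ, ∑ j, z j * ψ ((2 ^ k) ^ n * j) = 0 := by
    intro n
    induction n with
    | zero => simpa using h0
    | succ n ih =>
      have h3 := congrArg (fun t => t ^ 2 ^ k) ih
      simp only [sum_pow_char_pow] at h3
      rw [zero_pow (by positivity)] at h3
      rw [← h3]
      apply Finset.sum_congr rfl
      intro j _
      rw [mul_pow, hz, ← AddChar.map_nsmul_eq_pow]
      congr 2
      rw [nsmul_eq_mul]
      push_cast
      ring
  have hu : ∀ u : ZMod p, u ≠ 0 → ∑ j, z j * ψ (u * j) = 0 := by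
    intro u hu
    obtain ⟨n, rfl⟩ := exists_pow_eq h2 hk u hu
    exact step n
  have key : ∀ x : ZMod p, (p : Ω) * z x = ∑ j, z j := by
    intro x
    have e1 : ∑ u : ZMod p, ψ (-(u * x)) * ∑ j, z j * ψ (u * j) = ∑ j, z j := by
      rw [Finset.sum_eq_single 0]
      · simp
      · intro u _ h; rw [hu u h, mul_zero]
      · simp
    rw [← e1]
    simp_rw [Finset.mul_sum]
    rw [Finset.sum_comm]
    have e2 : ∀ j : ZMod p, ∑ u : ZMod p, ψ (-(u * x)) * (z j * ψ (u * j)) =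
        z j * (if j - x = 0 then (Fintype.card (ZMod p) : ℕ) else 0 : ℕ) := by
      intro j
      rw [← AddChar.sum_mulShift (j - x) hψ, Finset.mul_sum]
      apply Finset.sum_congr rfl
      intro u _
      rw [mul_left_comm, ← AddChar.map_add_eq_mul]
      congr 2; ring
    simp_rw [e2]
    rw [Finset.sum_eq_single x]
    · simp [ZMod.card, mul_comm]
    · intro j _ h
      simp [sub_eq_zero, h]
    · simp
  exact mul_left_cancel₀ hodd ((key x).trans (key y).symm)

theorem sum_shift {R : Type*} [AddCommGroup R] (f : ℕ → R) (M : ℕ) (hf : ∀ t, f (t + M) = f t) (i : ℕ) :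
    ∑ t ∈ Finset.range M, f (t + i) = ∑ t ∈ Finset.range M, f t := by
  induction i with
  | zero => rfl
  | succ i ih =>
    rw [← ih]
    have h1 := Finset.sum_range_succ (fun t => f (t + i)) M
    have h2 := Finset.sum_range_succ' (fun t => f (t + i)) M
    rw [h1] at h2
    have h3 : f (M + i) = f (0 + i) := by rw [zero_add, add_comm, hf]
    rw [h3] at h2
    have h4 := add_right_cancel h2
    rw [h4]
    apply Finset.sum_congr rfl
    intro t _
    congr 1; ring

theorem sum_range_mul' {R : Type*} [AddCommMonoid R] (f : ℕ → R) (m n : ℕ) :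
    ∑ t ∈ Finset.range (m * n), f t =
      ∑ i ∈ Finset.range n, ∑ r ∈ Finset.range m, f (m * i + r) := by
  induction n with
  | zero => simp
  | succ n ih => rw [Nat.mul_succ, Finset.sum_range_add, ih, Finset.sum_range_succ]

/-- the shift operator -/
noncomputable def E : Module.End (ZMod 2) (ℕ → ZMod 2) := LinearMap.funLeft (ZMod 2) (ZMod 2) (· + 1)

theorem E_pow (i : ℕ) (v : ℕ → ZMod 2) (t : ℕ) : (E ^ i) v t = v (t + i) := by
  induction i generalizing t with
  | zero => rfl
  | succ i ih =>
    rw [pow_succ']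
    change (E ^ i) v (t + 1) = _
    rw [ih]; congr 1; ring

theorem aeval_E (P : (ZMod 2)[X]) (v : ℕ → ZMod 2) (t : ℕ) :
    (aeval E P) v t = ∑ i ∈ Finset.range (P.natDegree + 1), P.coeff i * v (t + i) := by
  rw [Polynomial.aeval_eq_sum_range]
  simp [LinearMap.sum_apply, Finset.sum_apply, E_pow]

theorem eval_mul_transform {Ω : Type*} [Field Ω] [Algebra (ZMod 2) Ω] (P : (ZMod 2)[X])
    (D : ℕ → ZMod 2) (hPD : aeval E P D = 0) (M : ℕ) (hD : ∀ t, D (t + M) = D t) (β : Ω)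
    (hβ : β ^ M = 1) (hβ0 : β ≠ 0) :
    aeval β P * ∑ t ∈ Finset.range M, algebraMap (ZMod 2) Ω (D t) * β⁻¹ ^ t = 0 := by
  have h : ∀ t, ∑ i ∈ Finset.range (P.natDegree + 1),
      algebraMap (ZMod 2) Ω (P.coeff i) * algebraMap (ZMod 2) Ω (D (t + i)) = 0 := by
    intro t
    have := aeval_E P D t
    rw [hPD] at this
    have := congrArg (algebraMap (ZMod 2) Ω) this
    simp only [map_sum, map_mul] at this
    rw [← this]; simp
  rw [Polynomial.aeval_eq_sum_range, Finset.sum_mul]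
  have e : ∀ i, (P.coeff i • β ^ i) * ∑ t ∈ Finset.range M, algebraMap (ZMod 2) Ω (D t) * β⁻¹ ^ t
      = ∑ t ∈ Finset.range M, β⁻¹ ^ t *
        (algebraMap (ZMod 2) Ω (P.coeff i) * algebraMap (ZMod 2) Ω (D (t + i))) := by
    intro i
    rw [← sum_shift (fun t => algebraMap (ZMod 2) Ω (D t) * β⁻¹ ^ t) M _ i, Finset.mul_sum]
    · apply Finset.sum_congr rfl
      intro t _
      rw [Algebra.smul_def, pow_add, inv_pow β i]
      field_simp
    · intro t
      simp only [hD, pow_add, inv_pow β M, hβ]; simp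
  simp_rw [e]
  rw [Finset.sum_comm]
  simp_rw [← Finset.mul_sum, h]
  simp

theorem transform_ne_zero {p k m S : ℕ} [Fact p.Prime] (h2 : orderOf (2 : ZMod p) = p - 1)
    (hk : Nat.Coprime (p - 1) k) (hm : m + 1 = 2 ^ k) (hm0 : 0 < m) (hS0 : 0 < S)
    (hmS : Nat.Coprime m S)
    (hlt : 2 * (m * S) < p)
    {Ω : Type*} [Field Ω] [CharP Ω 2] [Algebra (ZMod 2) Ω] (hodd : (p : Ω) ≠ 0)
    (s : ℕ → ℕ) (hs : ∀ t, s (t + m) = s t + S) (hsS : ∀ t, t ≤ m → s t ≤ S)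
    (g : ZMod p → ZMod 2) (hg : ¬ ∀ x y, g x = g y)
    (θ : Ω) (hθ : θ ^ (m * p) = 1) (hθm : θ ^ m ≠ 1) :
    ∑ t ∈ Finset.range (m * p), algebraMap (ZMod 2) Ω (g (s (t + 1))) * θ ^ t ≠ 0 := by
  have hp : p.Prime := Fact.out
  have hθ0 : θ ≠ 0 := by
    rintro rfl
    rw [zero_pow (by have := hp.pos; positivity)] at hθ
    exact zero_ne_one hθ
  have hSp : (S : ZMod p) ≠ 0 := by
    rw [Ne, ZMod.natCast_eq_zero_iff]
    intro h; have := Nat.le_of_dvd hS0 h; nlinarith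
  have hmp : (m : ZMod p) ≠ 0 := by
    rw [Ne, ZMod.natCast_eq_zero_iff]
    intro h; have := Nat.le_of_dvd hm0 h; nlinarith
  have hprim : IsPrimitiveRoot (θ ^ m) p := by
    rw [IsPrimitiveRoot.iff_orderOf]
    exact orderOf_eq_prime (by rw [← pow_mul, hθ]) hθm
  -- character
  let χ := AddChar.zmodChar p hprim.pow_eq_one
  have hχ : χ.IsPrimitive := AddChar.zmodChar_primitive_of_primitive_root p hprim
  have hχ1 : χ 1 = θ ^ m := by
    have := AddChar.zmodChar_apply' hprim.pow_eq_one 1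
    simpa using this
  have hχi : ∀ i : ℕ, χ (i : ZMod p) = (θ ^ m) ^ i := fun i =>
    AddChar.zmodChar_apply' hprim.pow_eq_one i
  let ψ := AddChar.mulShift χ (S : ZMod p)⁻¹
  have hψa : ∀ x, ψ x = χ ((S : ZMod p)⁻¹ * x) := fun x => rfl
  have hψ : ψ.IsPrimitive := by
    apply AddChar.IsPrimitive.of_ne_one
    intro h
    have : ψ (S : ZMod p) = 1 := by rw [h]; rfl
    rw [hψa, inv_mul_cancel₀ hSp, hχ1] at this
    exact hθm this
  -- G
  let G := ∑ j, algebraMap (ZMod 2) Ω (g j) * ψ j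
  have hG : G ≠ 0 := by
    intro h
    apply hg
    intro x y
    have := all_eq_of_sum h2 hk hodd ψ hψ (fun j => algebraMap (ZMod 2) Ω (g j)) (by
      intro j
      rw [← map_pow]
      congr 1
      generalize g j = w
      have : w ^ 2 ^ k = w := ZMod.pow_card_pow w
      exact this) h x y
    exact (algebraMap (ZMod 2) Ω).injective this
  have hsi : ∀ t i, s (t + m * i) = s t + S * i := by
    intro t i
    induction i with
    | zero => simp
    | succ i ih => rw [Nat.mul_succ, ← add_assoc, hs, ih]; ring
  have inner : ∀ x : ZMod p, ∑ i ∈ Finset.range p, algebraMap (ZMod 2) Ω (g (x + S * (i : ℕ))) * (θ ^ m) ^ i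
      = ψ (-x) * G := by
    intro x
    have e1 : ∑ i ∈ Finset.range p, algebraMap (ZMod 2) Ω (g (x + S * (i : ℕ))) * (θ ^ m) ^ i
        = ∑ i : ZMod p, algebraMap (ZMod 2) Ω (g (x + S * i)) * χ i := by
      symm
      apply Finset.sum_bij (fun (i : ZMod p) _ => i.val)
      · intro i _; simp [ZMod.val_lt]
      · intro i _ j _ h; exact ZMod.val_injective p h
      · intro i hi
        refine ⟨(i : ZMod p), Finset.mem_univ _, ?_⟩
        rw [ZMod.val_natCast, Nat.mod_eq_of_lt (Finset.mem_range.1 hi)]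
      · intro i _
        rw [← hχi, ZMod.natCast_zmod_val]
    rw [e1, Finset.mul_sum]
    refine Fintype.sum_equiv ((Equiv.mulLeft₀ (S : ZMod p) hSp).trans (Equiv.addLeft x)) _ _ ?_
    intro i
    have : χ i = ψ (-x) * ψ (x + S * i) := by
      rw [← AddChar.map_add_eq_mul, hψa]
      congr 1
      field_simp
      ring
    rw [this]
    change _ = ψ (-x) * (algebraMap (ZMod 2) Ω (g (x + S * i)) * ψ (x + S * i))
    ring
  have total : ∑ t ∈ Finset.range (m * p), algebraMap (ZMod 2) Ω (g (s (t + 1))) * θ ^ t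
      = G * ∑ r ∈ Finset.range m, θ ^ r * ψ (-(s (r + 1) : ZMod p)) := by
    rw [sum_range_mul', Finset.sum_comm, Finset.mul_sum]
    apply Finset.sum_congr rfl
    intro r _
    rw [mul_left_comm, mul_comm G, ← inner, Finset.mul_sum]
    apply Finset.sum_congr rfl
    intro i _
    have : m * i + r + 1 = (r + 1) + m * i := by ring
    rw [this, hsi]
    push_cast
    rw [pow_add, pow_mul]
    ring
  rw [total]
  apply mul_ne_zero hG
  intro hzero
  let e : ZMod p := S * (m : ZMod p)⁻¹
  let ζ := θ * ψ (-e)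
  have hψinv : ∀ x, ψ (-x) * ψ x = 1 := by
    intro x; rw [← AddChar.map_add_eq_mul]; simp
  have hζθ : θ = ζ * ψ e := by
    simp only [ζ]; rw [mul_assoc, hψinv, mul_one]
  have hζm : ζ ^ m = 1 := by
    simp only [ζ]
    rw [mul_pow, ← AddChar.map_nsmul_eq_pow, nsmul_eq_mul]
    have : (m : ZMod p) * -e = - S := by simp only [e]; field_simp
    rw [this]
    have h6 : ψ (S : ZMod p) = θ ^ m := by rw [hψa, inv_mul_cancel₀ hSp, hχ1]
    rw [← h6, mul_comm, hψinv]
  have hζk : ζ ^ 2 ^ k = ζ := by rw [← hm, pow_succ, hζm, one_mul]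
  let κ : ℕ → ZMod p := fun r => r * e - (s (r + 1) : ZMod p)
  have hκ : ∀ r < m, ∀ r' < m, κ r = κ r' → r = r' := by
    intro r hr r' hr' h
    have h7 : ((S * r + m * s (r' + 1) : ℕ) : ZMod p) = ((S * r' + m * s (r + 1) : ℕ) : ZMod p) := by
      have hme : (m : ZMod p) * e = S := by simp only [e]; field_simp
      push_cast
      rw [← hme]
      simp only [κ] at h
      linear_combination (m : ZMod p) * h
    rw [ZMod.natCast_eq_natCast_iff] at h7
    have b1 := hsS (r + 1) hr
    have b2 := hsS (r' + 1) hr'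
    have h8 : S * r + m * s (r' + 1) = S * r' + m * s (r + 1) := by
      apply Nat.ModEq.eq_of_lt_of_lt h7 <;> nlinarith
    have h9 : S * r ≡ S * r' [MOD m] := by
      have : S * r + m * s (r' + 1) ≡ S * r' + m * s (r + 1) [MOD m] := by rw [h8]
      simpa [Nat.ModEq] using this
    exact Nat.ModEq.eq_of_lt_of_lt (Nat.ModEq.cancel_left_of_coprime hmS h9) hr hr'
  let z : ZMod p → Ω := fun x => ∑ r ∈ Finset.range m, if κ r = x then ζ ^ r else 0
  have hz : ∀ x, z x ^ 2 ^ k = z x := by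
    intro x
    simp only [z]
    rw [sum_pow_char_pow]
    apply Finset.sum_congr rfl
    intro r _
    split_ifs
    · rw [← pow_mul, mul_comm, pow_mul, hζk]
    · rw [zero_pow (by positivity)]
  have hzs : ∑ x, z x * ψ x = 0 := by
    rw [← hzero]
    simp only [z, Finset.sum_mul]
    rw [Finset.sum_comm]
    apply Finset.sum_congr rfl
    intro r _
    rw [Finset.sum_eq_single (κ r)]
    · rw [if_pos rfl]
      have hθr : θ ^ r = ζ ^ r * ψ (r * e) := by
        rw [← nsmul_eq_mul, AddChar.map_nsmul_eq_pow, ← mul_pow, ← hζθ]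
      rw [hθr]
      simp only [κ]
      rw [sub_eq_add_neg, AddChar.map_add_eq_mul]
      ring
    · intro x _ hx
      rw [if_neg (Ne.symm hx), zero_mul]
    · simp
  have hall := all_eq_of_sum h2 hk hodd ψ hψ z hz hzs
  obtain ⟨x, hx⟩ : ∃ x : ZMod p, x ∉ (Finset.range m).image κ := by
    by_contra! hcon
    have h1 : (Finset.univ : Finset (ZMod p)).card ≤ ((Finset.range m).image κ).card :=
      Finset.card_le_card (fun x _ => hcon x)
    have h3 := Finset.card_image_le (s := Finset.range m) (f := κ)
    rw [Finset.card_univ, ZMod.card] at h1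
    rw [Finset.card_range] at h3
    nlinarith
  have zx : z x = 0 := by
    simp only [z]
    apply Finset.sum_eq_zero
    intro r hr
    rw [if_neg]
    rintro rfl
    exact hx (Finset.mem_image_of_mem _ hr)
  have z0 : z (κ 0) = 1 := by
    simp only [z]
    rw [Finset.sum_eq_single 0]
    · simp
    · intro r hr h
      rw [if_neg]
      intro h'
      exact h (hκ r (Finset.mem_range.1 hr) 0 hm0 h')
    · intro h; exact absurd (Finset.mem_range.2 hm0) h
  have := hall x (κ 0)
  rw [zx, z0] at this
  exact zero_ne_one this

theorem aeval_X_pow_sub_one (n : ℕ) (v : ℕ → ZMod 2) (t : ℕ) :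
    (aeval E (X ^ n - 1 : (ZMod 2)[X])) v t = v (t + n) - v t := by
  simp [E_pow]

theorem degree_bound {p k m S : ℕ} [Fact p.Prime] (h2 : orderOf (2 : ZMod p) = p - 1)
    (hk : Nat.Coprime (p - 1) k) (hm : m + 1 = 2 ^ k) (hm0 : 0 < m) (hS0 : 0 < S)
    (hmS : Nat.Coprime m S) (hmodd : Odd m) (hpodd : Odd p)
    (hlt : 2 * (m * S) < p)
    (s : ℕ → ℕ) (hs : ∀ t, s (t + m) = s t + S) (hsS : ∀ t, t ≤ m → s t ≤ S)
    (g : ZMod p → ZMod 2) (hg : ¬ ∀ x y, g x = g y)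
    (c : ℕ → ZMod 2) (hcg : ∀ t, c (t + m) - c t = g (s (t + 1)))
    (hcper : ¬ ∀ t, c (t + m * p) = c t)
    (P : (ZMod 2)[X]) (hP0 : P ≠ 0) (hP : aeval E P c = 0) :
    (p - 1) * m + 2 ≤ P.natDegree := by
  have hp : p.Prime := Fact.out
  have hM0 : 0 < m * p := Nat.mul_pos hm0 hp.pos
  let D : ℕ → ZMod 2 := aeval E (X ^ m - 1 : (ZMod 2)[X]) c
  have hD : ∀ t, D t = g (s (t + 1)) := fun t => by
    simp only [D]; rw [aeval_X_pow_sub_one, hcg]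
  have hsi : ∀ t i, s (t + m * i) = s t + S * i := by
    intro t i
    induction i with
    | zero => simp
    | succ i ih => rw [Nat.mul_succ, ← add_assoc, hs, ih]; ring
  have hDper : ∀ t, D (t + m * p) = D t := by
    intro t
    rw [hD, hD, add_right_comm, hsi]
    simp
  have hPD : aeval E P D = 0 := by
    simp only [D]
    rw [← Module.End.mul_apply, ← map_mul, mul_comm, map_mul, Module.End.mul_apply, hP, map_zero]
  have oddne : ∀ (F : Type) [Field F] [CharP F 2] (n : ℕ), Odd n → (n : F) ≠ 0 := by
    intro F _ _ n hn
    rw [Ne, CharP.cast_eq_zero_iff F 2]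
    exact hn.not_two_dvd_nat
  -- divisibility
  have hdvd : (X ^ (m * p) - 1 : (ZMod 2)[X]) ∣ (X ^ m - 1) * P := by
    let Ω := AlgebraicClosure (ZMod 2)
    rw [← Polynomial.map_dvd_map' (algebraMap (ZMod 2) Ω)]
    have hne1 : Polynomial.map (algebraMap (ZMod 2) Ω) (X ^ (m * p) - 1) ≠ 0 := by
      rw [Polynomial.map_ne_zero_iff (algebraMap (ZMod 2) Ω).injective]
      exact (monic_X_pow_sub_C (1 : ZMod 2) hM0.ne').ne_zero
    have hne2 : Polynomial.map (algebraMap (ZMod 2) Ω) ((X ^ m - 1) * P) ≠ 0 := by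
      rw [Polynomial.map_ne_zero_iff (algebraMap (ZMod 2) Ω).injective]
      exact mul_ne_zero (monic_X_pow_sub_C (1 : ZMod 2) hm0.ne').ne_zero hP0
    rw [IsAlgClosed.dvd_iff_roots_le_roots hne1 hne2, Multiset.le_iff_subset]
    · intro β hβ
      rw [mem_roots hne1] at hβ
      rw [mem_roots hne2]
      have hβ1 : β ^ (m * p) = 1 := by
        simpa [IsRoot, sub_eq_zero] using hβ
      by_cases hβm : β ^ m = 1
      · simp [IsRoot, hβm]
      · have hβ0 : β ≠ 0 := by
          rintro rfl
          rw [zero_pow hM0.ne'] at hβ1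
          exact zero_ne_one hβ1
        have h := eval_mul_transform P D hPD (m * p) hDper β hβ1 hβ0
        simp_rw [hD] at h
        have h' := transform_ne_zero h2 hk hm hm0 hS0 hmS hlt (Ω := Ω)
          (oddne Ω p hpodd) s hs hsS g hg β⁻¹ (by rw [inv_pow, hβ1, inv_one])
          (by rw [inv_pow]; simpa using hβm)
        have h'' := (mul_eq_zero.1 h).resolve_right h'
        rw [Polynomial.map_mul, IsRoot, eval_mul, eval_map_algebraMap, eval_map_algebraMap, h'',
          mul_zero]
    · apply nodup_roots
      apply Separable.map
      rw [X_pow_sub_one_separable_iff]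
      exact oddne (ZMod 2) _ (hmodd.mul hpodd)
  let Q : (ZMod 2)[X] := ∑ i ∈ Finset.range p, (X ^ m) ^ i
  have hQ : Q * (X ^ m - 1) = X ^ (m * p) - 1 := by
    simp only [Q]; rw [geom_sum_mul, pow_mul]
  have hXm : (X ^ m - 1 : (ZMod 2)[X]) ≠ 0 :=
    (monic_X_pow_sub_C (1 : ZMod 2) hm0.ne').ne_zero
  have hXM : (X ^ (m * p) - 1 : (ZMod 2)[X]) ≠ 0 :=
    (monic_X_pow_sub_C (1 : ZMod 2) hM0.ne').ne_zero
  have hQP : Q ∣ P := by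
    rw [← hQ, mul_comm] at hdvd
    exact (mul_dvd_mul_iff_left hXm).1 hdvd
  have hQ0 : Q ≠ 0 := by
    intro h; rw [h, zero_mul] at hQ; exact hXM hQ.symm
  have hQdeg : Q.natDegree = (p - 1) * m := by
    have h := congrArg natDegree hQ
    rw [natDegree_mul hQ0 hXm] at h
    have e1 : (X ^ m - 1 : (ZMod 2)[X]).natDegree = m := natDegree_X_pow_sub_C (r := (1 : ZMod 2))
    have e2 : (X ^ (m * p) - 1 : (ZMod 2)[X]).natDegree = m * p :=
      natDegree_X_pow_sub_C (r := (1 : ZMod 2))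
    rw [e1, e2] at h
    obtain ⟨p', rfl⟩ : ∃ p', p = p' + 1 := ⟨p - 1, by have := hp.pos; omega⟩
    rw [Nat.add_sub_cancel]
    nlinarith
  obtain ⟨R, hR⟩ := hQP
  have hR0 : R ≠ 0 := by rintro rfl; rw [mul_zero] at hR; exact hP0 hR
  by_contra hlt2
  have hRdeg : R.natDegree ≤ 1 := by
    have := natDegree_mul hQ0 hR0
    rw [← hR, hQdeg] at this
    omega
  have hMkill : ¬ aeval E (X ^ (m * p) - 1 : (ZMod 2)[X]) c = 0 := by
    intro h
    apply hcper
    intro t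
    have := congrFun h t
    rw [aeval_X_pow_sub_one] at this
    exact sub_eq_zero.1 this
  apply hMkill
  have mono : ∀ U V : (ZMod 2)[X], U ∣ V → aeval E U c = 0 → aeval E V c = 0 := by
    rintro U V ⟨W, rfl⟩ h
    rw [mul_comm, map_mul, Module.End.mul_apply, h, map_zero]
  by_cases hRd : R ∣ X ^ m - 1
  · apply mono P _ _ hP
    rw [hR, ← hQ]
    exact mul_dvd_mul_left Q hRd
  · have hirr : Irreducible R := by
      apply irreducible_of_degree_eq_one
      rw [degree_eq_natDegree hR0]
      have : R.natDegree ≠ 0 := by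
        intro h
        apply hRd
        apply IsUnit.dvd
        rw [Polynomial.isUnit_iff_degree_eq_zero, degree_eq_natDegree hR0, h]; rfl
      have : R.natDegree = 1 := by omega
      rw [this]; rfl
    have hcop : IsCoprime R ((X ^ m - 1) * (X ^ m - 1)) := by
      have : IsCoprime R (X ^ m - 1) := (hirr.coprime_iff_not_dvd).2 hRd
      exact this.mul_right this
    obtain ⟨u, v, huv⟩ := hcop
    have hQe : Q = u * P + v * ((X ^ (m * p) - 1) * (X ^ m - 1)) := by
      rw [hR, ← hQ]
      linear_combination (- Q) * huv
    have hkill : aeval E ((X ^ (m * p) - 1) * (X ^ m - 1) : (ZMod 2)[X]) c = 0 := by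
      rw [map_mul, Module.End.mul_apply]
      funext t
      rw [aeval_X_pow_sub_one]
      change D (t + m * p) - D t = 0
      rw [hDper, sub_self]
    apply mono Q _ ⟨_, hQ.symm⟩
    rw [hQe, map_add, map_mul, map_mul, LinearMap.add_apply, Module.End.mul_apply,
      Module.End.mul_apply, hP, hkill, map_zero, map_zero, add_zero]

theorem isLinearRecurrence_of_periodic (u : ℕ → ZMod 2) (N : ℕ) (hN : 0 < N)
    (h : ∀ t, 1 ≤ t → u (t + N) = u t) : IsLinearRecurrence u N := by
  refine ⟨fun i => if (i : ℕ) = N - 1 then 1 else 0, fun t ht => ?_⟩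
  rw [Finset.sum_eq_single (⟨N - 1, by omega⟩ : Fin N)]
  · rw [h t ht]
    simp only [if_pos, one_mul]
    congr 1
    omega
  · intro i _ hi
    have hne : ¬ (i : ℕ) = N - 1 := fun h => hi (Fin.ext h)
    simp [hne]
  · simp

theorem exists_poly (u : ℕ → ZMod 2) (L : ℕ) (h : IsLinearRecurrence u L) :
    ∃ P : (ZMod 2)[X], P ≠ 0 ∧ P.natDegree = L ∧ aeval E P (fun t => u (t + 1)) = 0 := by
  obtain ⟨lam, hl⟩ := h
  let W : (ZMod 2)[X] := ∑ i : Fin L, C (lam i) * X ^ (L - 1 - (i : ℕ))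
  have hW : W.degree < L := by
    rw [← mem_degreeLT]
    apply Submodule.sum_mem
    intro i _
    rw [mem_degreeLT]
    apply (degree_C_mul_X_pow_le _ _).trans_lt
    have := i.2
    exact_mod_cast (by omega : L - 1 - (i : ℕ) < L)
  have hmon : (X ^ L - W).Monic := monic_X_pow_sub hW
  refine ⟨X ^ L - W, hmon.ne_zero, ?_, ?_⟩
  · apply natDegree_eq_of_degree_eq_some
    rw [degree_sub_eq_left_of_degree_lt, degree_X_pow]
    rwa [degree_X_pow]
  · funext t
    have e : (aeval E (X ^ L - W)) (fun t => u (t + 1)) t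
        = u (t + L + 1) - ∑ i : Fin L, lam i * u (t + (L - 1 - (i : ℕ)) + 1) := by
      simp only [W, map_sub, map_sum, map_mul, map_pow, aeval_X, aeval_C, LinearMap.sub_apply,
        LinearMap.sum_apply, Pi.sub_apply, Finset.sum_apply, E_pow, Module.End.mul_apply,
        Module.algebraMap_end_apply, Pi.smul_apply, smul_eq_mul]
    rw [e]
    have := hl (t + 1) (by omega)
    rw [show t + L + 1 = t + 1 + L by ring, this]
    rw [Pi.zero_apply, sub_eq_zero]
    apply Finset.sum_congr rfl
    intro i _
    congr 2
    have := i.2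
    omega

theorem general {p k m S : ℕ} [Fact p.Prime] (h2 : orderOf (2 : ZMod p) = p - 1)
    (hk : Nat.Coprime (p - 1) k) (hm : m + 1 = 2 ^ k) (hm0 : 0 < m) (hSodd : Odd S)
    (hmS : Nat.Coprime m S) (hmodd : Odd m) (hpodd : Odd p)
    (hlt : 2 * (m * S) < p)
    (b : ℕ → ZMod 2) (hb : ∀ t, 1 ≤ t → b (t + 2 * p) = b t)
    (s : ℕ → ℕ) (hs : ∀ t, s (t + m) = s t + S) (hsS : ∀ t, t ≤ m → s t ≤ S)
    (hs1 : ∀ t, 1 ≤ s (t + 1))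
    (c : ℕ → ZMod 2) (hc : ∀ t, 1 ≤ t → c t = b (s t))
    (B' : ℕ → ZMod 2) (hB' : ∀ i, 1 ≤ i → B' i = b (s 1 + S * (i - 1)))
    (hL : linComplexity B' = p + 1)
    (hrec : ∀ t, 1 ≤ t → B' (t + p + 1) + B' (t + p) + B' (t + 1) + B' t = 0) :
    (p - 1) * m + 2 ≤ linComplexity c := by
  have hp : p.Prime := Fact.out
  have hS0 : 0 < S := hSodd.pos
  have hp2 : 2 < p := by nlinarith
  have hsi : ∀ t i, s (t + m * i) = s t + S * i := by
    intro t i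
    induction i with
    | zero => simp
    | succ i ih => rw [Nat.mul_succ, ← add_assoc, hs, ih]; ring
  have hbi : ∀ t, 1 ≤ t → ∀ i, b (t + 2 * p * i) = b t := by
    intro t ht i
    induction i with
    | zero => simp
    | succ i ih => rw [Nat.mul_succ, ← add_assoc, hb _ (by omega), ih]
  have hbmod : ∀ j j', 1 ≤ j → 1 ≤ j' → j ≡ j' [MOD 2 * p] → b j = b j' := by
    have aux : ∀ j j', 1 ≤ j → j ≤ j' → j ≡ j' [MOD 2 * p] → b j = b j' := by
      intro j j' h1 h2 h
      obtain ⟨i, hi⟩ := (Nat.modEq_iff_dvd' h2).1 h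
      have : j' = j + 2 * p * i := by omega
      rw [this, hbi j h1]
    intro j j' h1 h1' h
    rcases le_total j j' with h3 | h3
    · exact aux _ _ h1 h3 h
    · exact (aux _ _ h1' h3 h.symm).symm
  let d : ℕ → ZMod 2 := fun j => b (j + S) + b j
  have hcop : Nat.Coprime S (2 * p) := by
    apply Nat.Coprime.mul_right
    · exact hSodd.coprime_two_right
    · apply Nat.Coprime.symm
      rw [hp.coprime_iff_not_dvd]
      intro h; have := Nat.le_of_dvd hS0 h; nlinarith
  have hd : ∀ j, 1 ≤ j → d (j + p) = d j := by
    intro j hj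
    obtain ⟨i, hi⟩ : ∃ i : ℕ, s 1 + S * i ≡ j [MOD 2 * p] := by
      haveI : NeZero (2 * p) := ⟨by omega⟩
      have hu : ((S : ZMod (2 * p))) * (S : ZMod (2 * p))⁻¹ = 1 := ZMod.coe_mul_inv_eq_one S hcop
      refine ⟨((S : ZMod (2 * p))⁻¹ * (j - s 1)).val, ?_⟩
      rw [← ZMod.natCast_eq_natCast_iff]
      push_cast
      rw [ZMod.natCast_zmod_val, ← mul_assoc, hu]
      ring
    have h0 := hs1 0
    rw [zero_add] at h0
    have r := hrec (i + 1) (by omega)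
    rw [hB' _ (by omega), hB' _ (by omega), hB' _ (by omega), hB' _ (by omega)] at r
    have hSp : S * p ≡ p [MOD 2 * p] := by
      obtain ⟨w, rfl⟩ := hSodd
      rw [Nat.modEq_iff_dvd]
      refine ⟨-(w : ℤ), ?_⟩
      push_cast; ring
    simp only [d]
    have c1 : b (j + p + S) = b (s 1 + S * (i + 1 + p + 1 - 1)) := by
      apply hbmod _ _ (by omega) (by omega)
      have : s 1 + S * (i + 1 + p + 1 - 1) = (s 1 + S * i) + S * p + S := by
        rw [show i + 1 + p + 1 - 1 = i + p + 1 by omega]; ring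
      rw [this]
      exact ((hi.add hSp).add_right S).symm
    have c2 : b (j + p) = b (s 1 + S * (i + 1 + p - 1)) := by
      apply hbmod _ _ (by omega) (by omega)
      have : s 1 + S * (i + 1 + p - 1) = (s 1 + S * i) + S * p := by
        rw [show i + 1 + p - 1 = i + p by omega]; ring
      rw [this]
      exact (hi.add hSp).symm
    have c3 : b (j + S) = b (s 1 + S * (i + 1 + 1 - 1)) := by
      apply hbmod _ _ (by omega) (by omega)
      have : s 1 + S * (i + 1 + 1 - 1) = (s 1 + S * i) + S := by
        rw [show i + 1 + 1 - 1 = i + 1 by omega]; ring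
      rw [this]
      exact (hi.add_right S).symm
    have c4 : b j = b (s 1 + S * (i + 1 - 1)) := by
      apply hbmod _ _ (by omega) (by omega)
      rw [show i + 1 - 1 = i by omega]
      exact hi.symm
    rw [c1, c2, c3, c4]
    rw [add_assoc] at r
    have := eq_neg_of_add_eq_zero_left r
    rw [this, CharTwo.neg_eq]
  have hdi : ∀ j, 1 ≤ j → ∀ i, d (j + p * i) = d j := by
    intro t ht i
    induction i with
    | zero => simp
    | succ i ih => rw [Nat.mul_succ, ← add_assoc, hd _ (by omega), ih]
  let g : ZMod p → ZMod 2 := fun x => d (x.val + p)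
  have hgd : ∀ j : ℕ, 1 ≤ j → g (j : ZMod p) = d j := by
    intro j hj
    simp only [g]
    rw [ZMod.val_natCast, ← hd j hj]
    have h3 : d (j % p + p + p * (j / p)) = d (j % p + p) := hdi _ (by omega) _
    rw [← h3]
    congr 1
    have := Nat.mod_add_div j p
    omega
  have hg : ¬ ∀ x y, g x = g y := by
    intro h
    have hper : ∀ t, 1 ≤ t → B' (t + 2) = B' t := by
      intro t ht
      have h0 := hs1 0
      rw [zero_add] at h0
      have hh := h ((s 1 + S * (t - 1) : ℕ) : ZMod p) ((s 1 + S * t : ℕ) : ZMod p)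
      rw [hgd _ (by omega), hgd _ (by omega)] at hh
      rw [hB' _ (by omega), hB' _ ht]
      simp only [d] at hh
      obtain ⟨t', rfl⟩ : ∃ t', t = t' + 1 := ⟨t - 1, by omega⟩
      rw [show t' + 1 + 2 - 1 = t' + 2 by omega]
      rw [show t' + 1 - 1 = t' by omega] at hh ⊢
      rw [show s 1 + S * t' + S = s 1 + S * (t' + 1) by ring,
        show s 1 + S * (t' + 1) + S = s 1 + S * (t' + 2) by ring,
        add_comm (b (s 1 + S * (t' + 2)))] at hh
      exact (add_left_cancel hh).symm
    have : linComplexity B' ≤ 2 :=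
      Nat.sInf_le (isLinearRecurrence_of_periodic B' 2 (by omega) hper)
    omega
  have hcper : ∀ t, 1 ≤ t → c (t + m * (2 * p)) = c t := by
    intro t ht
    have h1 : 1 ≤ s t := by
      have := hs1 (t - 1)
      rwa [Nat.sub_add_cancel ht] at this
    rw [hc _ (by omega), hc _ ht, hsi, mul_comm S, hbi _ h1]
  have hmem : IsLinearRecurrence c (linComplexity c) := by
    have : linComplexity c ∈ {L | IsLinearRecurrence c L} :=
      Nat.sInf_mem ⟨m * (2 * p), isLinearRecurrence_of_periodic c _
        (Nat.mul_pos hm0 (by omega)) hcper⟩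
    exact this
  obtain ⟨P, hP0, hPd, hP⟩ := exists_poly c _ hmem
  rw [← hPd]
  refine degree_bound h2 hk hm hm0 hS0 hmS hmodd hpodd hlt s hs hsS g hg
    (fun t => c (t + 1)) ?_ ?_ P hP0 hP
  · intro t
    rw [hgd _ (hs1 t)]
    simp only [d]
    rw [hc _ (by omega), hc _ (by omega), CharTwo.sub_eq_add, add_right_comm, hs]
  · intro h
    have hper : ∀ t, 1 ≤ t → B' (t + p) = B' t := by
      intro t ht
      have hh := h (m * (t - 1))
      rw [hc _ (by omega), hc _ (by omega)] at hh
      rw [show m * (t - 1) + m * p + 1 = 1 + m * (t + p - 1) by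
        rw [show t + p - 1 = (t - 1) + p by omega]; ring,
        show m * (t - 1) + 1 = 1 + m * (t - 1) by ring, hsi, hsi] at hh
      rw [hB' _ (by omega), hB' _ ht, hh]
    have : linComplexity B' ≤ p :=
      Nat.sInf_le (isLinearRecurrence_of_periodic B' p hp.pos hper)
    omega

end Lifi

/-- **LIFI-128.** Let `p` be a prime with `q = 2p + 1` prime,
`2^88 ≤ q < 2^89`, `2` a primitive root mod `q` and mod `p`, and `gcd (p-1) 39 = 1`.
Let `b` be the FCSR sequence `b i = parity of (A * 2^{-i} mod q)` for a fixed
`1 ≤ A ≤ q - 1`, which has period `n = 2p`. Let `m = 2^39 - 1`, let `a` be an integer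
control sequence with `1 ≤ a i ≤ 4`, period `m`, partial sums `s`, and
`s m = 5 * 2^38 - 1`, and let `c t = b (s t)` be the clock-controlled keystream.
Assume (from FCSR theory) that the characteristic polynomial of the shortest linear
recurrence of the decimated sequence `(b (s 1 + s m * i))_{i ≥ 0}` is
`(x + 1) * (x^p + 1)`.  Then `L(c) ≥ (p - 1) * (2^39 - 1) + 2`. -/
theorem lifi128_linComplexity_lower_bound
    (p q : ℕ) (hp : Nat.Prime p) (hq : Nat.Prime q) (hq2p : q = 2 * p + 1)
    (hqlb : 2 ^ 88 ≤ q) (hqub : q < 2 ^ 89)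
    (hprimq : orderOf (2 : ZMod q) = q - 1)
    (hprimp : orderOf (2 : ZMod p) = p - 1)
    (hgcd39 : Nat.gcd (p - 1) 39 = 1)
    (A : ℕ) (hA1 : 1 ≤ A) (hA2 : A ≤ q - 1)
    (b : ℕ → ZMod 2)
    (hbdef : ∀ i : ℕ, b i = (((A : ZMod q) * ((2 : ZMod q)⁻¹) ^ i).val : ZMod 2))
    (hbper : ∀ t, 1 ≤ t → b (t + 2 * p) = b t)
    (a : ℕ → ℕ) (ha : ∀ i, 1 ≤ i → 1 ≤ a i ∧ a i ≤ 4)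
    (haper : ∀ t, 1 ≤ t → a (t + (2 ^ 39 - 1)) = a t)
    (s : ℕ → ℕ) (hs : ∀ k, s k = ∑ i ∈ Finset.Icc 1 k, a i)
    (hsm : s (2 ^ 39 - 1) = 5 * 2 ^ 38 - 1)
    (c : ℕ → ZMod 2) (hc : ∀ t, 1 ≤ t → c t = b (s t))
    (B' : ℕ → ZMod 2)
    (hB' : ∀ i, 1 ≤ i → B' i = b (s 1 + s (2 ^ 39 - 1) * (i - 1)))
    (hHdeg : linComplexity B' =
      ((Polynomial.X + 1) * (Polynomial.X ^ p + 1) : Polynomial (ZMod 2)).natDegree)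
    (hHrec : ∀ t, 1 ≤ t →
      ∑ i ∈ Finset.range
          (((Polynomial.X + 1) * (Polynomial.X ^ p + 1) : Polynomial (ZMod 2)).natDegree + 1),
        ((Polynomial.X + 1) * (Polynomial.X ^ p + 1) : Polynomial (ZMod 2)).coeff i * B' (t + i)
          = 0) :
    (p - 1) * (2 ^ 39 - 1) + 2 ≤ linComplexity c := by
  haveI : Fact p.Prime := ⟨hp⟩
  have hpbig : 2 ^ 87 ≤ p := by omega
  have hdeg : ((Polynomial.X + 1) * (Polynomial.X ^ p + 1) : Polynomial (ZMod 2)).natDegree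
      = p + 1 := by
    have m1 : (Polynomial.X + 1 : Polynomial (ZMod 2)).Monic := Polynomial.monic_X_add_C 1
    have m2 : (Polynomial.X ^ p + 1 : Polynomial (ZMod 2)).Monic :=
      Polynomial.monic_X_pow_add_C 1 hp.ne_zero
    have d1 : (Polynomial.X + 1 : Polynomial (ZMod 2)).natDegree = 1 :=
      Polynomial.natDegree_X_add_C 1
    have d2 : (Polynomial.X ^ p + 1 : Polynomial (ZMod 2)).natDegree = p :=
      Polynomial.natDegree_X_pow_add_C (r := (1 : ZMod 2))
    rw [m1.natDegree_mul m2, d1, d2, add_comm]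
  have hrec : ∀ t, 1 ≤ t → B' (t + p + 1) + B' (t + p) + B' (t + 1) + B' t = 0 := by
    intro t ht
    have h := hHrec t ht
    obtain ⟨t', rfl⟩ : ∃ t', t = t' + 1 := ⟨t - 1, by omega⟩
    have e := Lifi.aeval_E ((Polynomial.X + 1) * (Polynomial.X ^ p + 1) : Polynomial (ZMod 2))
      (fun t => B' (t + 1)) t'
    have e2 : ∀ i, t' + i + 1 = t' + 1 + i := fun i => by ring
    simp only [e2] at e
    rw [h] at e
    have e3 : ((Polynomial.X + 1) * (Polynomial.X ^ p + 1) : Polynomial (ZMod 2))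
        = Polynomial.X ^ (p + 1) + Polynomial.X ^ p + Polynomial.X ^ 1 + 1 := by ring
    rw [e3] at e
    simp only [map_add, map_pow, Polynomial.aeval_X, map_one, LinearMap.add_apply, Pi.add_apply,
      Lifi.E_pow, Module.End.one_apply] at e
    rw [← e]
    congr 1
    congr 1
    congr 1
    · congr 1; ring
    · congr 1; ring
  have hsucc : ∀ t, s (t + 1) = s t + a (t + 1) := by
    intro t
    rw [hs, hs, Finset.sum_Icc_succ_top (by omega)]
  have hs0 : s 0 = 0 := by rw [hs]; rfl
  have hmono : Monotone s := monotone_nat_of_le_succ (fun t => by rw [hsucc]; omega)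
  have hs1 : ∀ t, 1 ≤ s (t + 1) := by
    intro t
    have := (ha (t + 1) (by omega)).1
    rw [hsucc]; omega
  have hshift : ∀ t, s (t + (2 ^ 39 - 1)) = s t + (5 * 2 ^ 38 - 1) := by
    intro t
    induction t with
    | zero => rw [zero_add, hs0, zero_add, hsm]
    | succ t ih =>
      rw [add_right_comm, hsucc, ih, hsucc, add_right_comm t, haper _ (by omega)]
      ring
  rw [hsm] at hB'
  refine Lifi.general (k := 39) (m := 2 ^ 39 - 1) (S := 5 * 2 ^ 38 - 1) hprimp hgcd39 (by norm_num)
    (by norm_num) (by decide) (by norm_num) (by decide) ?_ ?_ b hbper s hshift ?_ hs1 c hc B' hB'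
    (hHdeg.trans hdeg) hrec
  · exact hp.odd_of_ne_two (by omega)
  · refine lt_of_lt_of_le ?_ hpbig
    norm_num
  · intro t ht
    rw [← hsm]
    exact hmono ht
end
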